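/- arXiv:1006.1990 — 11 statements merged into one kernel-verified Lean document; each statement's English description precedes it below -/
import Mathlib

section
/- Strong duality: assume additionally that all capacities c_{si}, c_{it} are nonnegative integers and every f_Q is integer-valued. Then there exist a feasible flow φ* and a set S* ⊆ V with value(φ*) = f(S*); consequently (combined with weak duality) the maximum of value(φ) over feasible flows is attained and equals min_{S⊆V} f(S). -/
open Finset

/-- A feasible flow for the submodular maximum-flow formulation of the paper. -/
def FeasibleFlow {V : Type*} [Fintype V] [DecidableEq V]
    (𝒬 : Finset (Finset V)) (cs ct : V → ℝ) (f : Finset V → Finset V → ℝ)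
    (φs φt : V → ℝ) (φ : Finset V → V → ℝ) : Prop :=
  (∀ i, 0 ≤ φs i ∧ φs i ≤ cs i) ∧
  (∀ i, 0 ≤ φt i ∧ φt i ≤ ct i) ∧
  (∀ i, φs i = φt i + ∑ Q ∈ 𝒬.filter (fun Q => i ∈ Q), φ Q i) ∧
  (∀ Q ∈ 𝒬, (∀ S ⊆ Q, ∑ i ∈ S, φ Q i ≤ f Q S) ∧ ∑ i ∈ Q, φ Q i = 0)

/-- The objective function `f(S)`. -/
def objVal {V : Type*} [Fintype V] [DecidableEq V]
    (𝒬 : Finset (Finset V)) (cs ct : V → ℝ) (f : Finset V → Finset V → ℝ)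
    (S : Finset V) : ℝ :=
  ∑ i ∈ S, ct i + ∑ i ∈ Sᶜ, cs i + ∑ Q ∈ 𝒬, f Q (S ∩ Q)

lemma sd_exists_eps {α : Type*} [DecidableEq α] (s : Finset α) (g : α → ℝ) (h : ∀ x ∈ s, 0 < g x) :
    ∃ ε : ℝ, 0 < ε ∧ ∀ x ∈ s, ε ≤ g x := by
  induction s using Finset.induction_on with
  | empty => exact ⟨1, one_pos, by simp⟩
  | insert a s ha ih =>
    obtain ⟨ε, h0, h1⟩ := ih (fun x hx => h x (Finset.mem_insert_of_mem hx))
    refine ⟨min ε (g a), lt_min h0 (h a (Finset.mem_insert_self _ _)), ?_⟩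
    intro x hx
    rcases Finset.mem_insert.1 hx with rfl | hx
    · exact min_le_right _ _
    · exact (min_le_left _ _).trans (h1 x hx)

/-- Membership in the base polyhedron. -/
def SdBase {V : Type*} (f : Finset V → ℝ) (Q : Finset V) (z : V → ℝ) : Prop :=
  (∀ S ⊆ Q, ∑ i ∈ S, z i ≤ f S) ∧ ∑ i ∈ Q, z i = 0

lemma SdBase.mix {V : Type*} {f : Finset V → ℝ} {Q : Finset V} {z w : V → ℝ}
    (hz : SdBase f Q z) (hw : SdBase f Q w) {a b : ℝ} (ha : 0 ≤ a) (hb : 0 ≤ b) (hab : a + b = 1) :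
    SdBase f Q (fun i => a * z i + b * w i) := by
  constructor
  · intro S hS
    rw [Finset.sum_add_distrib, ← Finset.mul_sum, ← Finset.mul_sum]
    have h1 := mul_le_mul_of_nonneg_left (hz.1 S hS) ha
    have h2 := mul_le_mul_of_nonneg_left (hw.1 S hS) hb
    have : f S = a * f S + b * f S := by rw [← add_mul, hab, one_mul]
    linarith
  · rw [Finset.sum_add_distrib, ← Finset.mul_sum, ← Finset.mul_sum, hz.2, hw.2]; simp

/-- If no tight set separates `i` from `j`, one can exchange. -/
lemma sd_exchange {V : Type*} [DecidableEq V] {f : Finset V → ℝ} {Q : Finset V} {z : V → ℝ}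
    (hz : SdBase f Q z) {i j : V} (hi : i ∈ Q) (hj : j ∈ Q)
    (h : ∀ T ⊆ Q, i ∈ T → j ∉ T → ∑ k ∈ T, z k ≠ f T) :
    ∃ ε : ℝ, 0 < ε ∧
      SdBase f Q (fun k => z k + ((if k = i then ε else 0) - (if k = j then ε else 0))) := by
  obtain ⟨ε, h0, h1⟩ := sd_exists_eps (Q.powerset.filter (fun T => i ∈ T ∧ j ∉ T))
    (fun T => f T - ∑ k ∈ T, z k) (by
      intro T hT
      simp only [Finset.mem_filter, Finset.mem_powerset] at hT
      have := lt_of_le_of_ne (hz.1 T hT.1) (h T hT.1 hT.2.1 hT.2.2)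
      linarith)
  refine ⟨ε, h0, ?_, ?_⟩
  · intro T hT
    rw [Finset.sum_add_distrib, Finset.sum_sub_distrib, Finset.sum_ite_eq', Finset.sum_ite_eq']
    have hb := hz.1 T hT
    by_cases hiT : i ∈ T <;> by_cases hjT : j ∈ T <;> simp only [hiT, hjT, if_true, if_false]
    · linarith
    · have := h1 T (by simp [hT, hiT, hjT])
      linarith
    · linarith
    · linarith
  · rw [Finset.sum_add_distrib, Finset.sum_sub_distrib, Finset.sum_ite_eq', Finset.sum_ite_eq']
    simp [hi, hj, hz.2]

lemma sd_tight {V : Type*} [DecidableEq V] {f : Finset V → ℝ} {Q : Finset V} {z : V → ℝ}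
    (hsub : ∀ S ⊆ Q, ∀ T ⊆ Q, f (S ∪ T) + f (S ∩ T) ≤ f S + f T)
    (hz : SdBase f Q z) {A B : Finset V} (hA : A ⊆ Q) (hB : B ⊆ Q)
    (tA : ∑ k ∈ A, z k = f A) (tB : ∑ k ∈ B, z k = f B) :
    ∑ k ∈ A ∪ B, z k = f (A ∪ B) ∧ ∑ k ∈ A ∩ B, z k = f (A ∩ B) := by
  have h1 := hz.1 (A ∪ B) (Finset.union_subset hA hB)
  have h2 := hz.1 (A ∩ B) (Finset.inter_subset_left.trans hA)
  have h3 := Finset.sum_union_inter (s₁ := A) (s₂ := B) (f := z)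
  have h4 := hsub A hA B hB
  constructor <;> linarith

lemma sd_uncross {V : Type*} [DecidableEq V] {f : Finset V → ℝ} {Q : Finset V} {z : V → ℝ}
    (hsub : ∀ S ⊆ Q, ∀ T ⊆ Q, f (S ∪ T) + f (S ∩ T) ≤ f S + f T)
    (he : f ∅ = 0) (hf : f Q = 0)
    (hz : SdBase f Q z) (S : Finset V)
    (h : ∀ i ∈ Q, i ∈ S → ∀ j ∈ Q, j ∉ S → ∃ T ⊆ Q, i ∈ T ∧ j ∉ T ∧ ∑ k ∈ T, z k = f T) :
    ∑ k ∈ S ∩ Q, z k = f (S ∩ Q) := by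
  have c1 : ∀ i ∈ Q, i ∈ S → ∀ J : Finset V, J ⊆ Q \ S →
      ∃ T ⊆ Q, i ∈ T ∧ (∀ j ∈ J, j ∉ T) ∧ ∑ k ∈ T, z k = f T := by
    intro i hi hiS J
    induction J using Finset.induction_on with
    | empty => intro _; exact ⟨Q, subset_rfl, hi, by simp, by rw [hz.2, hf]⟩
    | insert a J ha ih =>
      intro hJ
      obtain ⟨T, hT, iT, jT, tT⟩ := ih ((Finset.subset_insert _ _).trans hJ)
      have haa := Finset.mem_sdiff.1 (hJ (Finset.mem_insert_self _ _))
      obtain ⟨U, hU, iU, aU, tU⟩ := h i hi hiS a haa.1 haa.2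
      refine ⟨T ∩ U, Finset.inter_subset_left.trans hT, Finset.mem_inter.2 ⟨iT, iU⟩, ?_,
        (sd_tight hsub hz hT hU tT tU).2⟩
      intro j hj hjm
      rw [Finset.mem_inter] at hjm
      rcases Finset.mem_insert.1 hj with rfl | hj
      · exact aU hjm.2
      · exact jT j hj hjm.1
  have c2 : ∀ I : Finset V, I ⊆ S ∩ Q → ∃ T ⊆ S ∩ Q, I ⊆ T ∧ ∑ k ∈ T, z k = f T := by
    intro I
    induction I using Finset.induction_on with
    | empty => intro _; exact ⟨∅, by simp, by simp, by simp [he]⟩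
    | insert a I ha ih =>
      intro hI
      obtain ⟨T, hT, iT, tT⟩ := ih ((Finset.subset_insert _ _).trans hI)
      have haa := Finset.mem_inter.1 (hI (Finset.mem_insert_self _ _))
      obtain ⟨U, hU, aU, jU, tU⟩ := c1 a haa.2 haa.1 (Q \ S) subset_rfl
      have hUS : U ⊆ S ∩ Q := by
        intro x hx
        by_contra hc
        refine jU x (Finset.mem_sdiff.2 ⟨hU hx, ?_⟩) hx
        intro hxS
        exact hc (Finset.mem_inter.2 ⟨hxS, hU hx⟩)
      refine ⟨T ∪ U, Finset.union_subset hT hUS, ?_,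
        (sd_tight hsub hz (hT.trans Finset.inter_subset_right) hU tT tU).1⟩
      exact Finset.insert_subset (Finset.mem_union_right _ aU) (iT.trans Finset.subset_union_left)
  obtain ⟨T, hT, hT', t⟩ := c2 _ subset_rfl
  rwa [Finset.Subset.antisymm hT hT'] at t

lemma sd_swap {V : Type*} [Fintype V] [DecidableEq V] (𝒬 : Finset (Finset V))
    (φ : Finset V → V → ℝ) (S : Finset V) :
    ∑ i ∈ S, ∑ Q ∈ 𝒬.filter (fun Q => i ∈ Q), φ Q i = ∑ Q ∈ 𝒬, ∑ i ∈ S ∩ Q, φ Q i := by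
  simp only [Finset.sum_filter]
  rw [Finset.sum_comm]
  refine Finset.sum_congr rfl fun Q _ => ?_
  rw [← Finset.sum_filter, Finset.filter_mem_eq_inter]

lemma sd_value {V : Type*} [Fintype V] [DecidableEq V] (𝒬 : Finset (Finset V))
    (φs φt : V → ℝ) (φ : Finset V → V → ℝ)
    (h : ∀ i, φs i = φt i + ∑ Q ∈ 𝒬.filter (fun Q => i ∈ Q), φ Q i) (S : Finset V) :
    ∑ i, φs i = ∑ i ∈ S, φt i + ∑ i ∈ Sᶜ, φs i + ∑ Q ∈ 𝒬, ∑ i ∈ S ∩ Q, φ Q i := by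
  rw [← Finset.sum_add_sum_compl S φs, ← sd_swap]
  have : ∑ i ∈ S, φs i = ∑ i ∈ S, φt i + ∑ i ∈ S, ∑ Q ∈ 𝒬.filter (fun Q => i ∈ Q), φ Q i := by
    rw [← Finset.sum_add_distrib]
    exact Finset.sum_congr rfl fun i _ => h i
  rw [this]; ring

lemma sd_weak {V : Type*} [Fintype V] [DecidableEq V]
    (𝒬 : Finset (Finset V)) (cs ct : V → ℝ) (f : Finset V → Finset V → ℝ)
    (φs φt : V → ℝ) (φ : Finset V → V → ℝ) (h : FeasibleFlow 𝒬 cs ct f φs φt φ) (S : Finset V) :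
    ∑ i, φs i ≤ objVal 𝒬 cs ct f S := by
  obtain ⟨h1, h2, h3, h4⟩ := h
  rw [sd_value 𝒬 φs φt φ h3 S, objVal]
  refine add_le_add (add_le_add ?_ ?_) ?_
  · exact Finset.sum_le_sum fun i _ => (h2 i).2
  · exact Finset.sum_le_sum fun i _ => (h1 i).2
  · exact Finset.sum_le_sum fun Q hQ => (h4 Q hQ).1 _ Finset.inter_subset_right

lemma sd_max {V : Type*} [Fintype V] [DecidableEq V]
    (𝒬 : Finset (Finset V)) (cs ct : V → ℝ) (f : Finset V → Finset V → ℝ)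
    (hcs : ∀ i, 0 ≤ cs i) (hct : ∀ i, 0 ≤ ct i)
    (hnonneg : ∀ Q ∈ 𝒬, ∀ S ⊆ Q, 0 ≤ f Q S) :
    ∃ (φs φt : V → ℝ) (φ : Finset V → V → ℝ), FeasibleFlow 𝒬 cs ct f φs φt φ ∧
      ∀ (φs' φt' : V → ℝ) (φ' : Finset V → V → ℝ),
            FeasibleFlow 𝒬 cs ct f φs' φt' φ' → ∑ i, φs' i ≤ ∑ i, φs i := by
  classical
  let lo : Finset V → V → ℝ := fun Q i => if Q ∈ 𝒬 ∧ i ∈ Q then - f Q (Q.erase i) else 0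
  let hi : Finset V → V → ℝ := fun Q i => if Q ∈ 𝒬 ∧ i ∈ Q then f Q {i} else 0
  let F : Set ((V → ℝ) × (V → ℝ) × (Finset V → V → ℝ)) := {x | FeasibleFlow 𝒬 cs ct f x.1 x.2.1 x.2.2}
  have hF : IsClosed F := by
    have e : F = {x : ((V → ℝ) × (V → ℝ) × (Finset V → V → ℝ)) | (∀ i, 0 ≤ x.1 i ∧ x.1 i ≤ cs i)} ∩ ({x : ((V → ℝ) × (V → ℝ) × (Finset V → V → ℝ)) | (∀ i, 0 ≤ x.2.1 i ∧ x.2.1 i ≤ ct i)} ∩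
      ({x : ((V → ℝ) × (V → ℝ) × (Finset V → V → ℝ)) | ∀ i, x.1 i = x.2.1 i + ∑ Q ∈ 𝒬.filter (fun Q => i ∈ Q), x.2.2 Q i} ∩
      {x : ((V → ℝ) × (V → ℝ) × (Finset V → V → ℝ)) | ∀ Q ∈ 𝒬, (∀ S ⊆ Q, ∑ i ∈ S, x.2.2 Q i ≤ f Q S) ∧ ∑ i ∈ Q, x.2.2 Q i = 0})) := rfl
    rw [e]
    simp only [Set.ofPred_forall, Set.ofPred_and]
    refine IsClosed.inter ?_ (IsClosed.inter ?_ (IsClosed.inter ?_ ?_))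
    · exact isClosed_iInter fun i => (isClosed_le (by fun_prop) (by fun_prop)).inter
        (isClosed_le (by fun_prop) (by fun_prop))
    · exact isClosed_iInter fun i => (isClosed_le (by fun_prop) (by fun_prop)).inter
        (isClosed_le (by fun_prop) (by fun_prop))
    · exact isClosed_iInter fun i => (isClosed_eq (by fun_prop) (by fun_prop))
    · exact isClosed_iInter fun Q => isClosed_iInter fun hQ =>
        (isClosed_iInter fun S => isClosed_iInter fun hS =>
          (isClosed_le (by fun_prop) (by fun_prop))).inter (isClosed_eq (by fun_prop) (by fun_prop))
  have hK : IsCompact (Set.Icc ((0, 0, lo) : ((V → ℝ) × (V → ℝ) × (Finset V → V → ℝ))) (cs, ct, hi) ∩ F) := isCompact_Icc.inter_right hF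
  have hcont : ContinuousOn (fun x : ((V → ℝ) × (V → ℝ) × (Finset V → V → ℝ)) => ∑ i, x.1 i) (Set.Icc ((0, 0, lo) : ((V → ℝ) × (V → ℝ) × (Finset V → V → ℝ))) (cs, ct, hi) ∩ F) := by
    apply Continuous.continuousOn; fun_prop
  have hne : (Set.Icc ((0, 0, lo) : ((V → ℝ) × (V → ℝ) × (Finset V → V → ℝ))) (cs, ct, hi) ∩ F).Nonempty := by
    refine ⟨(0, 0, 0), ⟨⟨le_rfl, le_rfl, ?_⟩, hcs, hct, ?_⟩, ?_⟩
    · intro Q i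
      simp only [lo]
      split_ifs with h
      · have := hnonneg Q h.1 (Q.erase i) (Finset.erase_subset _ _)
        simpa using this
      · simp
    · intro Q i
      simp only [hi]
      split_ifs with h
      · exact hnonneg Q h.1 _ (Finset.singleton_subset_iff.2 h.2)
      · simp
    · refine ⟨fun i => ⟨le_rfl, hcs i⟩, fun i => ⟨le_rfl, hct i⟩, by simp, fun Q hQ => ⟨fun S hS => ?_, by simp⟩⟩
      simpa using hnonneg Q hQ S hS
  obtain ⟨x, hx, hmax⟩ := hK.exists_isMaxOn hne hcont
  refine ⟨x.1, x.2.1, x.2.2, hx.2, ?_⟩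
  intro φs' φt' φ' hφ'
  obtain ⟨h1, h2, h3, h4⟩ := hφ'
  let ψ : Finset V → V → ℝ := fun Q i => if Q ∈ 𝒬 ∧ i ∈ Q then φ' Q i else 0
  have hψ : ∀ Q ∈ 𝒬, ∀ S ⊆ Q, ∑ i ∈ S, ψ Q i = ∑ i ∈ S, φ' Q i := by
    intro Q hQ S hS
    exact Finset.sum_congr rfl fun i hi => if_pos ⟨hQ, hS hi⟩
  have hmem : ((φs', φt', ψ) : ((V → ℝ) × (V → ℝ) × (Finset V → V → ℝ))) ∈ Set.Icc ((0, 0, lo) : ((V → ℝ) × (V → ℝ) × (Finset V → V → ℝ))) (cs, ct, hi) ∩ F := by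
    refine ⟨⟨⟨fun i => (h1 i).1, fun i => (h2 i).1, ?_⟩, fun i => (h1 i).2, fun i => (h2 i).2, ?_⟩, h1, h2, ?_, ?_⟩
    · intro Q i
      simp only [lo, ψ]
      split_ifs with h
      · have a := (h4 Q h.1).1 (Q.erase i) (Finset.erase_subset _ _)
        have b := (h4 Q h.1).2
        rw [← Finset.add_sum_erase _ _ h.2] at b
        linarith
      · exact le_rfl
    · intro Q i
      simp only [hi, ψ]
      split_ifs with h
      · simpa using (h4 Q h.1).1 {i} (Finset.singleton_subset_iff.2 h.2)
      · exact le_rfl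
    · intro i
      refine (h3 i).trans ?_
      congr 1
      refine Finset.sum_congr rfl fun Q hQ => ?_
      exact (if_pos (Finset.mem_filter.1 hQ)).symm
    · intro Q hQ
      refine ⟨fun S hS => ?_, ?_⟩
      · exact (hψ Q hQ S hS).trans_le ((h4 Q hQ).1 S hS)
      · exact (hψ Q hQ Q subset_rfl).trans (h4 Q hQ).2
  exact hmax hmem

/-- `j` can receive extra flow `ε` from the source. -/
def SdReach {V : Type*} [Fintype V] [DecidableEq V]
    (𝒬 : Finset (Finset V)) (cs : V → ℝ) (f : Finset V → Finset V → ℝ)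
    (φt : V → ℝ) (j : V) : Prop :=
  ∃ (ε : ℝ) (ψs : V → ℝ) (ψ : Finset V → V → ℝ), 0 < ε ∧
    (∀ i, 0 ≤ ψs i ∧ ψs i ≤ cs i) ∧
    (∀ i, ψs i = φt i + (if i = j then ε else 0) + ∑ Q ∈ 𝒬.filter (fun Q => i ∈ Q), ψ Q i) ∧
    (∀ Q ∈ 𝒬, SdBase (f Q) Q (ψ Q))

lemma sd_box {x y c a b : ℝ} (hx : 0 ≤ x ∧ x ≤ c) (hy : 0 ≤ y ∧ y ≤ c) (ha : 0 ≤ a) (hb : 0 ≤ b)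
    (hab : a + b = 1) : 0 ≤ a * x + b * y ∧ a * x + b * y ≤ c := by
  refine ⟨add_nonneg (mul_nonneg ha hx.1) (mul_nonneg hb hy.1), ?_⟩
  have h1 := mul_le_mul_of_nonneg_left hx.2 ha
  have h2 := mul_le_mul_of_nonneg_left hy.2 hb
  have : c = a * c + b * c := by rw [← add_mul, hab, one_mul]
  linarith

lemma sd_reach_start {V : Type*} [Fintype V] [DecidableEq V]
    {𝒬 : Finset (Finset V)} {cs ct : V → ℝ} {f : Finset V → Finset V → ℝ}
    {φs φt : V → ℝ} {φ : Finset V → V → ℝ} (h : FeasibleFlow 𝒬 cs ct f φs φt φ) {j : V}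
    (hj : φs j < cs j) : SdReach 𝒬 cs f φt j := by
  obtain ⟨h1, h2, h3, h4⟩ := h
  refine ⟨cs j - φs j, fun i => φs i + if i = j then cs j - φs j else 0, φ, by linarith, ?_, ?_, h4⟩
  · intro i
    have := h1 i
    dsimp only
    split_ifs with hij
    · subst hij; constructor <;> linarith
    · simpa using this
  · intro i
    dsimp only
    rw [h3 i]; ring

lemma sd_reach_step {V : Type*} [Fintype V] [DecidableEq V]
    {𝒬 : Finset (Finset V)} {cs ct : V → ℝ} {f : Finset V → Finset V → ℝ}
    {φs φt : V → ℝ} {φ : Finset V → V → ℝ} (h : FeasibleFlow 𝒬 cs ct f φs φt φ) {i j : V}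
    (hi : SdReach 𝒬 cs f φt i) {R : Finset V} (hR : R ∈ 𝒬) (hiR : i ∈ R) (hjR : j ∈ R)
    {δ : ℝ} (hδ : 0 < δ)
    (hex : SdBase (f R) R (fun k => φ R k + ((if k = i then δ else 0) - (if k = j then δ else 0)))) :
    SdReach 𝒬 cs f φt j := by
  obtain ⟨h1, h2, h3, h4⟩ := h
  obtain ⟨ε, ψs, ψ, hε, g1, g3, g4⟩ := hi
  have hs : 0 < δ + ε := by linarith
  let a := δ / (δ + ε)
  let b := ε / (δ + ε)
  have ha : 0 < a := div_pos hδ hs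
  have hb : 0 < b := div_pos hε hs
  have hab : a + b = 1 := by simp only [a, b]; field_simp
  have hae : a * ε = b * δ := by simp only [a, b]; field_simp
  let χ : Finset V → V → ℝ := fun Q k =>
    φ Q k + if Q = R then ((if k = i then δ else 0) - (if k = j then δ else 0)) else 0
  have hχ : ∀ Q ∈ 𝒬, SdBase (f Q) Q (χ Q) := by
    intro Q hQ
    by_cases hQR : Q = R
    · subst hQR; simpa [χ] using hex
    · have : χ Q = φ Q := by funext k; simp [χ, hQR]
      rw [this]; exact h4 Q hQ
  refine ⟨b * δ, fun k => a * ψs k + b * φs k, fun Q k => a * ψ Q k + b * χ Q k, mul_pos hb hδ,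
    fun k => sd_box (g1 k) (h1 k) ha.le hb.le hab, ?_, fun Q hQ => (g4 Q hQ).mix (hχ Q hQ) ha.le hb.le hab⟩
  intro k
  dsimp only
  have e1 : ∑ Q ∈ 𝒬.filter (fun Q => k ∈ Q), χ Q k = ∑ Q ∈ 𝒬.filter (fun Q => k ∈ Q), φ Q k
      + ((if k = i then δ else 0) - (if k = j then δ else 0)) := by
    simp only [χ]
    rw [Finset.sum_add_distrib, Finset.sum_ite_eq']
    congr 1
    by_cases hk : k ∈ R
    · simp [hk, hR]
    · have hki : k ≠ i := fun e => hk (e ▸ hiR)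
      have hkj : k ≠ j := fun e => hk (e ▸ hjR)
      simp [hki, hkj]
  rw [Finset.sum_add_distrib, ← Finset.mul_sum, ← Finset.mul_sum, e1, g3 k, h3 k]
  have e2 : φt k = a * φt k + b * φt k := by rw [← add_mul, hab, one_mul]
  have e3 : a * (if k = i then ε else 0) = b * (if k = i then δ else 0) := by
    split_ifs <;> simp [hae]
  have e4 : (if k = j then b * δ else 0) = b * (if k = j then δ else 0) := by
    split_ifs <;> simp
  rw [e4]
  linarith

lemma sd_reach_end {V : Type*} [Fintype V] [DecidableEq V]
    {𝒬 : Finset (Finset V)} {cs ct : V → ℝ} {f : Finset V → Finset V → ℝ}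
    {φs φt : V → ℝ} {φ : Finset V → V → ℝ} (h : FeasibleFlow 𝒬 cs ct f φs φt φ) {j : V}
    (hj : SdReach 𝒬 cs f φt j) (hlt : φt j < ct j) :
    ∃ (φs' φt' : V → ℝ) (φ' : Finset V → V → ℝ), FeasibleFlow 𝒬 cs ct f φs' φt' φ' ∧
      ∑ i, φs i < ∑ i, φs' i := by
  have hF := h
  obtain ⟨h1, h2, h3, h4⟩ := h
  obtain ⟨ε, ψs, ψ, hε, g1, g3, g4⟩ := hj
  have hd : 0 < ct j - φt j := by linarith
  have hs : 0 < (ct j - φt j) + ε := by linarith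
  let a := (ct j - φt j) / ((ct j - φt j) + ε)
  let b := ε / ((ct j - φt j) + ε)
  have ha : 0 < a := div_pos hd hs
  have hb : 0 < b := div_pos hε hs
  have hab : a + b = 1 := by simp only [a, b]; field_simp
  have hae : a * ε = b * (ct j - φt j) := by simp only [a, b]; field_simp
  have hb1 : b * (ct j - φt j) ≤ ct j - φt j := by
    have : b ≤ 1 := by linarith
    nlinarith
  have hpos : 0 < a * ε := mul_pos ha hε
  have hcons : ∀ k, a * ψs k + b * φs k = (φt k + if k = j then a * ε else 0) +
      ∑ Q ∈ 𝒬.filter (fun Q => k ∈ Q), (a * ψ Q k + b * φ Q k) := by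
    intro k
    rw [Finset.sum_add_distrib, ← Finset.mul_sum, ← Finset.mul_sum, g3 k, h3 k]
    have e2 : φt k = a * φt k + b * φt k := by rw [← add_mul, hab, one_mul]
    have e4 : (if k = j then a * ε else 0) = a * (if k = j then ε else 0) := by
      split_ifs <;> simp
    rw [e4]
    linarith
  have hbase : ∀ Q ∈ 𝒬, SdBase (f Q) Q (fun k => a * ψ Q k + b * φ Q k) :=
    fun Q hQ => (g4 Q hQ).mix (h4 Q hQ) ha.le hb.le hab
  refine ⟨fun k => a * ψs k + b * φs k, fun k => φt k + if k = j then a * ε else 0,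
    fun Q k => a * ψ Q k + b * φ Q k,
    ⟨fun k => sd_box (g1 k) (h1 k) ha.le hb.le hab, ?_, hcons, hbase⟩, ?_⟩
  · intro k
    have := h2 k
    dsimp only
    split_ifs with hk
    · subst hk; constructor <;> linarith
    · simpa using this
  · rw [sd_value 𝒬 _ _ _ hcons Finset.univ, sd_value 𝒬 _ _ _ h3 Finset.univ]
    simp only [Finset.univ_inter, Finset.compl_univ, Finset.sum_empty]
    rw [Finset.sum_congr rfl fun Q hQ => (hbase Q hQ).2, Finset.sum_congr rfl fun Q hQ => (h4 Q hQ).2,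
      Finset.sum_add_distrib]
    simpa using hpos

/-- Strong duality: if all capacities are nonnegative integers and each `f_Q` is
integer-valued, then there exist a feasible flow `φ*` and a set `S*` with
`value(φ*) = f(S*)`; consequently the maximum of `value(φ)` is attained and equals
the minimum of `f`. -/
theorem strong_duality {V : Type*} [Fintype V] [DecidableEq V]
    (𝒬 : Finset (Finset V)) (cs ct : V → ℝ) (f : Finset V → Finset V → ℝ)
    (hQcard : ∀ Q ∈ 𝒬, 2 ≤ Q.card)
    (hcs : ∀ i, 0 ≤ cs i) (hct : ∀ i, 0 ≤ ct i)
    (hsub : ∀ Q ∈ 𝒬, ∀ S ⊆ Q, ∀ T ⊆ Q, f Q (S ∪ T) + f Q (S ∩ T) ≤ f Q S + f Q T)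
    (hnonneg : ∀ Q ∈ 𝒬, ∀ S ⊆ Q, 0 ≤ f Q S)
    (hempty : ∀ Q ∈ 𝒬, f Q ∅ = 0) (hfull : ∀ Q ∈ 𝒬, f Q Q = 0)
    (hcsInt : ∀ i, ∃ a : ℕ, cs i = a) (hctInt : ∀ i, ∃ a : ℕ, ct i = a)
    (hfInt : ∀ Q ∈ 𝒬, ∀ S ⊆ Q, ∃ a : ℤ, f Q S = a) :
    ∃ (φs φt : V → ℝ) (φ : Finset V → V → ℝ),
      FeasibleFlow 𝒬 cs ct f φs φt φ ∧
      ∃ S : Finset V,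
        (∑ i, φs i) = objVal 𝒬 cs ct f S ∧
        (∀ (φs' φt' : V → ℝ) (φ' : Finset V → V → ℝ),
            FeasibleFlow 𝒬 cs ct f φs' φt' φ' → ∑ i, φs' i ≤ ∑ i, φs i) ∧
        (∀ T : Finset V, objVal 𝒬 cs ct f S ≤ objVal 𝒬 cs ct f T) := by
  classical
  obtain ⟨φs, φt, φ, hF, hmax⟩ := sd_max 𝒬 cs ct f hcs hct hnonneg
  let S : Finset V := Finset.univ.filter (fun j => SdReach 𝒬 cs f φt j)
  have memS : ∀ j, j ∈ S ↔ SdReach 𝒬 cs f φt j := fun j => by simp [S]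
  have heq : ∑ i, φs i = objVal 𝒬 cs ct f S := by
    rw [sd_value 𝒬 φs φt φ hF.2.2.1 S, objVal]
    congr 1
    · congr 1
      · refine Finset.sum_congr rfl fun j hj => ?_
        refine le_antisymm (hF.2.1 j).2 (not_lt.1 fun hlt => ?_)
        obtain ⟨a, b, c, hf, hl⟩ := sd_reach_end hF ((memS j).1 hj) hlt
        exact absurd (hmax a b c hf) (not_le.2 hl)
      · refine Finset.sum_congr rfl fun j hj => ?_
        refine le_antisymm (hF.1 j).2 (not_lt.1 fun hlt => ?_)
        exact Finset.mem_compl.1 hj ((memS j).2 (sd_reach_start hF hlt))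
    · refine Finset.sum_congr rfl fun Q hQ => ?_
      have hB : SdBase (f Q) Q (φ Q) := hF.2.2.2 Q hQ
      refine sd_uncross (hsub Q hQ) (hempty Q hQ) (hfull Q hQ) hB S ?_
      intro i hi hiS j hj hjS
      by_contra hc
      push Not at hc
      obtain ⟨δ, hδ, hex⟩ := sd_exchange hB hi hj hc
      exact hjS ((memS j).2 (sd_reach_step hF ((memS i).1 hiS) hQ hi hj hδ hex))
  refine ⟨φs, φt, φ, hF, S, heq, hmax, fun T => ?_⟩
  rw [← heq]
  exact sd_weak 𝒬 cs ct f φs φt φ hF T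
end

section
/- Optimality certificate from non-reachability (Proposition 3): let φ be a feasible flow, and suppose there is no directed path from s to t in the residual graph (N, Ā). Then the set S = { i ∈ V : there is a directed path from s to i in (N, Ā) } satisfies f(S) = value(φ); consequently φ maximizes value(φ) over feasible flows and S minimizes f over subsets of V. -/
open Finset

/-- Nodes of the auxiliary graph: the source `s`, the sink `t`, the nodes of `V`,
and the copies `(Q,i)`. -/
inductive Node (V : Type*) where
  | s : Node V
  | t : Node V
  | vert : V → Node V
  | copy : Finset V → V → Node V

/-- The residual arc relation `Ā` of the residual graph `(N, Ā)` with respect to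
the flow `(φs, φt, φ)`: source/sink arcs with positive residual capacity, the
(uncapacitated) internal arcs, and the exchange arcs `((Q,i),(Q,j))` with strictly
positive exchange capacity `c̄_{Qij} = min { f_Q(S) − φ_Q(S) : i ∈ S ⊆ Q∖{j} }`. -/
def ResArc {V : Type*} [Fintype V] [DecidableEq V]
    (𝒬 : Finset (Finset V)) (cs ct : V → ℝ) (f : Finset V → Finset V → ℝ)
    (φs φt : V → ℝ) (φ : Finset V → V → ℝ) (u v : Node V) : Prop :=
  (∃ i, u = Node.s ∧ v = Node.vert i ∧ φs i < cs i) ∨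
  (∃ i, u = Node.vert i ∧ v = Node.s ∧ 0 < φs i) ∨
  (∃ i, u = Node.vert i ∧ v = Node.t ∧ φt i < ct i) ∨
  (∃ i, u = Node.t ∧ v = Node.vert i ∧ 0 < φt i) ∨
  (∃ Q i, Q ∈ 𝒬 ∧ i ∈ Q ∧
    ((u = Node.vert i ∧ v = Node.copy Q i) ∨ (u = Node.copy Q i ∧ v = Node.vert i))) ∨
  (∃ Q i j, Q ∈ 𝒬 ∧ i ∈ Q ∧ j ∈ Q ∧ i ≠ j ∧ u = Node.copy Q i ∧ v = Node.copy Q j ∧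
    ∀ S ⊆ Q, i ∈ S → j ∉ S → 0 < f Q S - ∑ a ∈ S, φ Q a)

theorem tight_of_separated {V : Type*} [DecidableEq V] (Q A : Finset V) (hA : A ⊆ Q)
    (g : Finset V → ℝ) (hn : ∀ S ⊆ Q, 0 ≤ g S)
    (hsub : ∀ S ⊆ Q, ∀ T ⊆ Q, g (S ∪ T) + g (S ∩ T) ≤ g S + g T)
    (h0 : g ∅ = 0) (hQ : g Q = 0)
    (hsep : ∀ i ∈ A, ∀ j ∈ Q, j ∉ A → ∃ X ⊆ Q, i ∈ X ∧ j ∉ X ∧ g X = 0) : g A = 0 := by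
  have hcl : ∀ S ⊆ Q, ∀ T ⊆ Q, g S = 0 → g T = 0 → g (S ∪ T) = 0 ∧ g (S ∩ T) = 0 := by
    intro S hS T hT h1 h2
    have a := hsub S hS T hT
    have b := hn (S ∪ T) (Finset.union_subset hS hT)
    have c := hn (S ∩ T) (Finset.inter_subset_left.trans hS)
    constructor <;> linarith
  have h1 : ∀ i ∈ A, ∀ J : Finset V, J ⊆ Q \ A →
      ∃ X ⊆ Q, i ∈ X ∧ (∀ j ∈ J, j ∉ X) ∧ g X = 0 := by
    intro i hi J
    induction J using Finset.induction_on with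
    | empty => intro _; exact ⟨Q, Finset.Subset.refl _, hA hi, by simp, hQ⟩
    | insert j J hj ih =>
      intro hJ
      obtain ⟨X, hX, hiX, hJX, hgX⟩ := ih (fun x hx => hJ (Finset.mem_insert_of_mem hx))
      have hjm := Finset.mem_sdiff.1 (hJ (Finset.mem_insert_self j J))
      obtain ⟨Y, hY, hiY, hjY, hgY⟩ := hsep i hi j hjm.1 hjm.2
      refine ⟨X ∩ Y, Finset.inter_subset_left.trans hX, Finset.mem_inter.2 ⟨hiX, hiY⟩, ?_,
        (hcl X hX Y hY hgX hgY).2⟩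
      intro k hk hkm
      have hkm := Finset.mem_inter.1 hkm
      rcases Finset.mem_insert.1 hk with rfl | hk
      · exact hjY hkm.2
      · exact hJX k hk hkm.1
  have h2 : ∀ I : Finset V, I ⊆ A → ∃ X ⊆ A, I ⊆ X ∧ g X = 0 := by
    intro I
    induction I using Finset.induction_on with
    | empty => intro _; exact ⟨∅, by simp, by simp, h0⟩
    | insert i I hi ih =>
      intro hI
      obtain ⟨X, hX, hIX, hgX⟩ := ih (fun x hx => hI (Finset.mem_insert_of_mem hx))
      obtain ⟨Y, hY, hiY, hJY, hgY⟩ :=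
        h1 i (hI (Finset.mem_insert_self i I)) (Q \ A) (Finset.Subset.refl _)
      have hYA : Y ⊆ A := by
        intro y hy
        by_contra hyA
        exact hJY y (Finset.mem_sdiff.2 ⟨hY hy, hyA⟩) hy
      refine ⟨X ∪ Y, Finset.union_subset hX hYA, ?_,
        (hcl X (hX.trans hA) Y hY hgX hgY).1⟩
      intro k hk
      rcases Finset.mem_insert.1 hk with rfl | hk
      · exact Finset.mem_union_right _ hiY
      · exact Finset.mem_union_left _ (hIX hk)
  obtain ⟨X, hX, hAX, hg⟩ := h2 A (Finset.Subset.refl _)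
  rwa [Finset.Subset.antisymm hX hAX] at hg

theorem flow_value_eq {V : Type*} [Fintype V] [DecidableEq V]
    (𝒬 : Finset (Finset V)) (φs φt : V → ℝ) (φ : Finset V → V → ℝ)
    (h : ∀ i, φs i = φt i + ∑ Q ∈ 𝒬.filter (fun Q => i ∈ Q), φ Q i) (T : Finset V) :
    ∑ i, φs i = ∑ i ∈ T, φt i + ∑ i ∈ Tᶜ, φs i + ∑ Q ∈ 𝒬, ∑ i ∈ T ∩ Q, φ Q i := by
  rw [← Finset.sum_add_sum_compl T φs]
  have : ∑ i ∈ T, φs i = ∑ i ∈ T, φt i + ∑ Q ∈ 𝒬, ∑ i ∈ T ∩ Q, φ Q i := by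
    rw [Finset.sum_congr rfl (fun i _ => h i), Finset.sum_add_distrib]
    congr 1
    simp_rw [Finset.sum_filter]
    rw [Finset.sum_comm]
    refine Finset.sum_congr rfl fun Q _ => ?_
    rw [← Finset.sum_filter, Finset.filter_mem_eq_inter]
  rw [this]; ring

theorem flow_weak_duality {V : Type*} [Fintype V] [DecidableEq V]
    (𝒬 : Finset (Finset V)) (cs ct : V → ℝ) (f : Finset V → Finset V → ℝ)
    (φs φt : V → ℝ) (φ : Finset V → V → ℝ)
    (h : FeasibleFlow 𝒬 cs ct f φs φt φ) (T : Finset V) :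
    ∑ i, φs i ≤ objVal 𝒬 cs ct f T := by
  obtain ⟨h1, h2, h3, h4⟩ := h
  rw [flow_value_eq 𝒬 φs φt φ h3 T, objVal]
  refine add_le_add (add_le_add ?_ ?_) ?_
  · exact Finset.sum_le_sum fun i _ => (h2 i).2
  · exact Finset.sum_le_sum fun i _ => (h1 i).2
  · exact Finset.sum_le_sum fun Q hQ => (h4 Q hQ).1 _ Finset.inter_subset_right

-- Proposition 3: if there is no path from `s` to `t` in the residual graph, then the
-- set `S` of nodes of `V` reachable from `s` satisfies `f(S) = value(φ)`; consequently `φ`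
-- is a maximum flow and `S` minimizes `f`.
open Classical in
theorem optimality_from_nonreachability {V : Type*} [Fintype V] [DecidableEq V]
    (𝒬 : Finset (Finset V)) (cs ct : V → ℝ) (f : Finset V → Finset V → ℝ)
    (hQcard : ∀ Q ∈ 𝒬, 2 ≤ Q.card)
    (hcs : ∀ i, 0 ≤ cs i) (hct : ∀ i, 0 ≤ ct i)
    (hsub : ∀ Q ∈ 𝒬, ∀ S ⊆ Q, ∀ T ⊆ Q, f Q (S ∪ T) + f Q (S ∩ T) ≤ f Q S + f Q T)
    (hnonneg : ∀ Q ∈ 𝒬, ∀ S ⊆ Q, 0 ≤ f Q S)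
    (hempty : ∀ Q ∈ 𝒬, f Q ∅ = 0) (hfull : ∀ Q ∈ 𝒬, f Q Q = 0)
    (φs φt : V → ℝ) (φ : Finset V → V → ℝ)
    (hfeas : FeasibleFlow 𝒬 cs ct f φs φt φ)
    (hnopath : ¬ Relation.ReflTransGen (ResArc 𝒬 cs ct f φs φt φ) Node.s Node.t) :
    objVal 𝒬 cs ct f
        (Finset.univ.filter fun i =>
          Relation.ReflTransGen (ResArc 𝒬 cs ct f φs φt φ) Node.s (Node.vert i))
      = ∑ i, φs i ∧
    (∀ (φs' φt' : V → ℝ) (φ' : Finset V → V → ℝ),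
        FeasibleFlow 𝒬 cs ct f φs' φt' φ' → ∑ i, φs' i ≤ ∑ i, φs i) ∧
    (∀ T : Finset V,
        objVal 𝒬 cs ct f
          (Finset.univ.filter fun i =>
            Relation.ReflTransGen (ResArc 𝒬 cs ct f φs φt φ) Node.s (Node.vert i))
        ≤ objVal 𝒬 cs ct f T) := by
  have key : objVal 𝒬 cs ct f
        (Finset.univ.filter fun i =>
          Relation.ReflTransGen (ResArc 𝒬 cs ct f φs φt φ) Node.s (Node.vert i))
      = ∑ i, φs i := by
    obtain ⟨h1, h2, h3, h4⟩ := hfeas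
    set S := (Finset.univ.filter fun i =>
          Relation.ReflTransGen (ResArc 𝒬 cs ct f φs φt φ) Node.s (Node.vert i)) with hS
    have hmem : ∀ i, i ∈ S ↔
        Relation.ReflTransGen (ResArc 𝒬 cs ct f φs φt φ) Node.s (Node.vert i) := by
      intro i; simp [hS]
    clear_value S
    rw [flow_value_eq 𝒬 φs φt φ h3 S, objVal]
    congr 1
    · congr 1
      · refine Finset.sum_congr rfl fun i hi => ?_
        refine le_antisymm (not_lt.1 fun hlt => hnopath ?_) (h2 i).2
        exact ((hmem i).1 hi).tail (Or.inr (Or.inr (Or.inl ⟨i, rfl, rfl, hlt⟩)))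
      · refine Finset.sum_congr rfl fun i hi => ?_
        refine le_antisymm (not_lt.1 fun hlt => Finset.mem_compl.1 hi ?_) (h1 i).2
        exact (hmem i).2 (Relation.ReflTransGen.single (Or.inl ⟨i, rfl, rfl, hlt⟩))
    · refine Finset.sum_congr rfl fun Q hQ => ?_
      have := tight_of_separated Q (S ∩ Q) Finset.inter_subset_right
        (fun X => f Q X - ∑ a ∈ X, φ Q a)
        (fun X hX => sub_nonneg.2 ((h4 Q hQ).1 X hX)) ?_ (by simp [hempty Q hQ])
        (by simp [hfull Q hQ, (h4 Q hQ).2]) ?_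
      · exact sub_eq_zero.1 this
      · intro X hX Y hY
        have a := hsub Q hQ X hX Y hY
        have b := Finset.sum_union_inter (s₁ := X) (s₂ := Y) (f := φ Q)
        linarith
      · intro i hi j hj hjA
        by_contra hcon
        have hi' := Finset.mem_inter.1 hi
        apply hjA
        refine Finset.mem_inter.2 ⟨(hmem j).2 ?_, hj⟩
        have r1 := ((hmem i).1 hi'.1).tail (c := Node.copy Q i)
          (Or.inr (Or.inr (Or.inr (Or.inr (Or.inl ⟨Q, i, hQ, hi'.2, Or.inl ⟨rfl, rfl⟩⟩)))))
        have r2 := r1.tail (c := Node.copy Q j)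
          (Or.inr (Or.inr (Or.inr (Or.inr (Or.inr ⟨Q, i, j, hQ, hi'.2, hj,
            fun e => hjA (e ▸ hi), rfl, rfl, fun X hX hiX hjX =>
              lt_of_le_of_ne (sub_nonneg.2 ((h4 Q hQ).1 X hX))
                fun e => hcon ⟨X, hX, hiX, hjX, e.symm⟩⟩)))))
        exact r2.tail
          (Or.inr (Or.inr (Or.inr (Or.inr (Or.inl ⟨Q, j, hQ, hj, Or.inr ⟨rfl, rfl⟩⟩)))))
  refine ⟨key, fun φs' φt' φ' h' => ?_, fun T => ?_⟩
  · rw [← key]; exact flow_weak_duality 𝒬 cs ct f φs' φt' φ' h' _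
  · rw [key]; exact flow_weak_duality 𝒬 cs ct f φs φt φ hfeas T
end

section
/- Per-term optimality lemma (core of Proposition 3's proof): let Q be a finite set and h : 2^Q → ℝ a submodular function with h(S) ≥ 0 for all S ⊆ Q and h(∅) = h(Q) = 0. Let S' ⊆ Q be such that for every i ∈ S' and every j ∈ Q∖S' there exists a set T with i ∈ T ⊆ Q∖{j} and h(T) = 0. Then h(S') = 0. -/
open Finset

/-- Per-term optimality lemma (core of Proposition 3's proof): if `h` is a nonnegative
submodular function on subsets of a finite set `Q` with `h(∅) = h(Q) = 0`, and `S'` is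
such that for every `i ∈ S'` and `j ∈ Q∖S'` there exists `T` with `i ∈ T ⊆ Q∖{j}` and
`h(T) = 0`, then `h(S') = 0`. (Here the ambient finite type plays the role of `Q`.) -/
theorem per_term_optimality {Q : Type*} [Fintype Q] [DecidableEq Q]
    (h : Finset Q → ℝ)
    (hsub : ∀ S T : Finset Q, h (S ∪ T) + h (S ∩ T) ≤ h S + h T)
    (hnn : ∀ S : Finset Q, 0 ≤ h S)
    (h0 : h ∅ = 0) (h1 : h Finset.univ = 0)
    (S' : Finset Q)
    (hex : ∀ i ∈ S', ∀ j ∉ S', ∃ T : Finset Q, i ∈ T ∧ j ∉ T ∧ h T = 0) :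
    h S' = 0 := by
  have hU : ∀ S T, h S = 0 → h T = 0 → h (S ∪ T) = 0 := fun S T a b => by
    linarith [hsub S T, hnn (S ∪ T), hnn (S ∩ T)]
  have hI : ∀ S T, h S = 0 → h T = 0 → h (S ∩ T) = 0 := fun S T a b => by
    linarith [hsub S T, hnn (S ∪ T), hnn (S ∩ T)]
  have c1 : ∀ i ∈ S', ∀ J : Finset Q, (∀ j ∈ J, j ∉ S') →
      ∃ T : Finset Q, i ∈ T ∧ (∀ j ∈ J, j ∉ T) ∧ h T = 0 := by
    intro i hi J
    induction J using Finset.induction_on with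
    | empty => exact fun _ => ⟨Finset.univ, by simp, by simp, h1⟩
    | insert a J _ ih =>
      intro hJ
      obtain ⟨T, hT, hTJ, hT0⟩ := ih (fun j hj => hJ j (Finset.mem_insert_of_mem hj))
      obtain ⟨R, hR, hRa, hR0⟩ := hex i hi a (hJ a (Finset.mem_insert_self a J))
      refine ⟨T ∩ R, Finset.mem_inter.2 ⟨hT, hR⟩, ?_, hI _ _ hT0 hR0⟩
      intro j hj hjT
      rw [Finset.mem_inter] at hjT
      rcases Finset.mem_insert.1 hj with rfl | hj
      · exact hRa hjT.2
      · exact hTJ j hj hjT.1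
  have c2 : ∀ A : Finset Q, A ⊆ S' → ∃ T : Finset Q, A ⊆ T ∧ T ⊆ S' ∧ h T = 0 := by
    intro A
    induction A using Finset.induction_on with
    | empty => exact fun _ => ⟨∅, by simp, by simp, h0⟩
    | insert a A _ ih =>
      intro hA
      rw [Finset.insert_subset_iff] at hA
      obtain ⟨T, hT, hTS, hT0⟩ := ih hA.2
      obtain ⟨R, hR, hRJ, hR0⟩ := c1 a hA.1 S'ᶜ (fun j hj => Finset.mem_compl.1 hj)
      refine ⟨T ∪ R, ?_, ?_, hU _ _ hT0 hR0⟩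
      · exact Finset.insert_subset (Finset.mem_union_right _ hR)
          (hT.trans Finset.subset_union_left)
      · refine Finset.union_subset hTS fun x hx => ?_
        by_contra hxS
        exact hRJ x (Finset.mem_compl.2 hxS) hx
  obtain ⟨T, h2, h3, h4⟩ := c2 S' (Finset.Subset.refl _)
  rwa [Finset.Subset.antisymm h2 h3]
end

section
/- Appendix A, Claim (a): let Q be a finite set, h : 2^Q → ℤ an integer-valued submodular function with h(S) ≥ 0 for all S ⊆ Q and h(∅) = h(Q) = 0, and let i, j, k, l be four pairwise distinct elements of Q. Suppose: h(S) ≥ 1 for every S with i ∈ S ⊆ Q∖{j}; h(S) ≥ 1 for every S with k ∈ S ⊆ Q∖{l}; and there exists S₀ with i ∈ S₀ ⊆ Q∖{l} and h(S₀) = 0. Define ĥ(S) = h(S) − [i ∈ S] + [j ∈ S] (Iverson brackets). Then ĥ(S) ≥ 1 for every S with k ∈ S ⊆ Q∖{l}. -/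
open Finset

/-- Appendix A, Claim (a): for an integer-valued nonnegative submodular `h` with
`h(∅) = h(Q) = 0` and pairwise distinct `i, j, k, l`, if every `S` with
`i ∈ S ⊆ Q∖{j}` has `h(S) ≥ 1`, every `S` with `k ∈ S ⊆ Q∖{l}` has `h(S) ≥ 1`, and
some `S₀` with `i ∈ S₀ ⊆ Q∖{l}` has `h(S₀) = 0`, then
`ĥ(S) = h(S) − [i ∈ S] + [j ∈ S] ≥ 1` for every `S` with `k ∈ S ⊆ Q∖{l}`. -/
theorem appendixA_claim_a {Q : Type*} [Fintype Q] [DecidableEq Q]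
    (h : Finset Q → ℤ)
    (hsub : ∀ S T : Finset Q, h (S ∪ T) + h (S ∩ T) ≤ h S + h T)
    (hnn : ∀ S : Finset Q, 0 ≤ h S)
    (h0 : h ∅ = 0) (h1 : h Finset.univ = 0)
    (i j k l : Q)
    (hij : i ≠ j) (hik : i ≠ k) (hil : i ≠ l)
    (hjk : j ≠ k) (hjl : j ≠ l) (hkl : k ≠ l)
    (harc_ij : ∀ S : Finset Q, i ∈ S → j ∉ S → 1 ≤ h S)
    (harc_kl : ∀ S : Finset Q, k ∈ S → l ∉ S → 1 ≤ h S)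
    (hmin : ∃ S₀ : Finset Q, i ∈ S₀ ∧ l ∉ S₀ ∧ h S₀ = 0) :
    ∀ S : Finset Q, k ∈ S → l ∉ S →
      1 ≤ h S - (if i ∈ S then 1 else 0) + (if j ∈ S then 1 else 0) := by
  intro S hkS hlS
  obtain ⟨S₀, hi0, hl0, hz⟩ := hmin
  have hS := harc_kl S hkS hlS
  by_cases hi : i ∈ S
  · by_cases hj : j ∈ S
    · simp only [hi, hj, if_true]
      linarith
    · have a := hsub S S₀
      have b := harc_kl (S ∪ S₀) (by simp [hkS]) (by simp [hlS, hl0])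
      have c := harc_ij (S ∩ S₀) (by simp [hi, hi0]) (by simp [hj])
      simp only [hi, hj, if_true, if_false]
      linarith
  · by_cases hj : j ∈ S
    · simp only [hi, hj, if_true, if_false]
      linarith
    · simp only [hi, hj, if_false]
      linarith
end

section
/- Appendix A, Claim (b): let Q be a finite set, h : 2^Q → ℝ a submodular function with h(S) ≥ 0 for all S ⊆ Q and h(∅) = h(Q) = 0, and let i, j, k, l, k', l' be six pairwise distinct elements of Q. Suppose: h(S) ≥ 1 for every S with i ∈ S ⊆ Q∖{j}, for every S with k ∈ S ⊆ Q∖{l}, and for every S with k' ∈ S ⊆ Q∖{l'}; there exists S₀ with i ∈ S₀ ⊆ Q∖{l'} and h(S₀) = 0; and there exists S₁ with k ∈ S₁ ⊆ Q∖{l'} and h(S₁) = 0. Define ĥ(S) = h(S) − [i ∈ S] + [j ∈ S]. Then there exists S₂ with k ∈ S₂ ⊆ Q∖{l'} and ĥ(S₂) = 0. -/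
open Finset

/-- Appendix A, Claim (b): for a nonnegative submodular `h` with `h(∅) = h(Q) = 0` and
pairwise distinct `i, j, k, l, k', l'`, if every `S` with `i ∈ S ⊆ Q∖{j}`, every `S`
with `k ∈ S ⊆ Q∖{l}` and every `S` with `k' ∈ S ⊆ Q∖{l'}` has `h(S) ≥ 1`, while some
`S₀` with `i ∈ S₀ ⊆ Q∖{l'}` and some `S₁` with `k ∈ S₁ ⊆ Q∖{l'}` have value `0`, then
for `ĥ(S) = h(S) − [i ∈ S] + [j ∈ S]` there exists `S₂` with `k ∈ S₂ ⊆ Q∖{l'}` and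
`ĥ(S₂) = 0`. -/
theorem appendixA_claim_b {Q : Type*} [Fintype Q] [DecidableEq Q]
    (h : Finset Q → ℝ)
    (hsub : ∀ S T : Finset Q, h (S ∪ T) + h (S ∩ T) ≤ h S + h T)
    (hnn : ∀ S : Finset Q, 0 ≤ h S)
    (h0 : h ∅ = 0) (h1 : h Finset.univ = 0)
    (i j k l k' l' : Q)
    (hij : i ≠ j) (hik : i ≠ k) (hil : i ≠ l) (hik' : i ≠ k') (hil' : i ≠ l')
    (hjk : j ≠ k) (hjl : j ≠ l) (hjk' : j ≠ k') (hjl' : j ≠ l')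
    (hkl : k ≠ l) (hkk' : k ≠ k') (hkl' : k ≠ l')
    (hlk' : l ≠ k') (hll' : l ≠ l') (hk'l' : k' ≠ l')
    (harc_ij : ∀ S : Finset Q, i ∈ S → j ∉ S → 1 ≤ h S)
    (harc_kl : ∀ S : Finset Q, k ∈ S → l ∉ S → 1 ≤ h S)
    (harc_k'l' : ∀ S : Finset Q, k' ∈ S → l' ∉ S → 1 ≤ h S)
    (hS0 : ∃ S₀ : Finset Q, i ∈ S₀ ∧ l' ∉ S₀ ∧ h S₀ = 0)
    (hS1 : ∃ S₁ : Finset Q, k ∈ S₁ ∧ l' ∉ S₁ ∧ h S₁ = 0) :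
    ∃ S₂ : Finset Q, k ∈ S₂ ∧ l' ∉ S₂ ∧
      h S₂ - (if i ∈ S₂ then (1 : ℝ) else 0) + (if j ∈ S₂ then (1 : ℝ) else 0) = 0 := by
  obtain ⟨A, hiA, hlA, hA⟩ := hS0
  obtain ⟨B, hkB, hlB, hB⟩ := hS1
  have hz : h (A ∪ B) = 0 := by
    linarith [hsub A B, hnn (A ∪ B), hnn (A ∩ B)]
  have hi : i ∈ A ∪ B := Finset.mem_union_left _ hiA
  have hj : j ∈ A ∪ B := by
    by_contra hc
    linarith [harc_ij _ hi hc]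
  refine ⟨A ∪ B, Finset.mem_union_right _ hkB, ?_, ?_⟩
  · intro hc
    rcases Finset.mem_union.mp hc with hc | hc
    · exact hlA hc
    · exact hlB hc
  · rw [if_pos hi, if_pos hj, hz]
    norm_num
end

section
/- Minimal augmentation preserves the base polyhedron (single-term form of Appendix A): let Q be a finite set, f : 2^Q → ℤ an integer-valued submodular function, and z ∈ ℤ^Q a vector in the base polyhedron B(f) (so f(∅) ≥ 0; assume f(∅) = 0). Let (i₁, j₁), …, (i_d, j_d) be pairs of elements of Q such that the 2d elements i₁, j₁, …, i_d, j_d are pairwise distinct, and write h(S) = f(S) − z(S). Suppose that for every t ∈ {1,…,d}: h(S) ≥ 1 for all S with i_t ∈ S ⊆ Q∖{j_t}; and for all t < t': there exists S with i_t ∈ S ⊆ Q∖{j_{t'}} and h(S) = 0 (minimality). Then the vector ẑ = z + Σ_{t=1}^{d} (e_{i_t} − e_{j_t}) also lies in B(f), where e_i denotes the i-th standard unit vector. -/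
open Finset

/-- Core induction, stated for the residual function `h`: peel off the last arc. -/
theorem residual_augment {Q : Type*} [DecidableEq Q] (d : ℕ) :
    ∀ (h : Finset Q → ℤ)
    (_ : ∀ S T : Finset Q, h (S ∪ T) + h (S ∩ T) ≤ h S + h T)
    (_ : ∀ S, 0 ≤ h S) (ii jj : Fin d → Q)
    (_ : ∀ t : Fin d, ∀ S : Finset Q, ii t ∈ S → jj t ∉ S → 1 ≤ h S)
    (_ : ∀ t t' : Fin d, t < t' → ∃ S : Finset Q, ii t ∈ S ∧ jj t' ∉ S ∧ h S = 0),
    ∀ S : Finset Q, ∑ t : Fin d,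
      ((if ii t ∈ S then (1 : ℤ) else 0) - if jj t ∈ S then (1 : ℤ) else 0) ≤ h S := by
  induction d with
  | zero => intro h _ h0 ii jj _ _ S; simpa using h0 S
  | succ d ih =>
    intro h hs h0 ii jj hc hm S
    set a := ii (Fin.last d) with ha
    set b := jj (Fin.last d) with hb
    have hcl : ∀ S, a ∈ S → b ∉ S → 1 ≤ h S := hc (Fin.last d)
    have hml : ∀ t : Fin d, ∃ D : Finset Q, ii t.castSucc ∈ D ∧ b ∉ D ∧ a ∉ D ∧ h D = 0 := by
      intro t
      obtain ⟨D, h1, h2, h3⟩ := hm t.castSucc (Fin.last d) (Fin.castSucc_lt_last t)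
      refine ⟨D, h1, h2, fun haD => ?_, h3⟩
      have := hcl D haD h2
      omega
    have key := ih (fun S => h S - ((if a ∈ S then (1 : ℤ) else 0) - if b ∈ S then (1 : ℤ) else 0))
      (by
        intro S T
        have := hs S T
        simp only [mem_union, mem_inter]
        by_cases h1 : a ∈ S <;> by_cases h2 : a ∈ T <;> by_cases h3 : b ∈ S <;>
          by_cases h4 : b ∈ T <;> simp [h1, h2, h3, h4] <;> linarith)
      (by
        intro S
        have h1 := h0 S
        have h2 := hcl S
        by_cases h3 : a ∈ S <;> by_cases h4 : b ∈ S <;> simp [h3, h4] at h2 ⊢ <;> linarith)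
      (fun t => ii t.castSucc) (fun t => jj t.castSucc)
      (by
        intro t S h1 h2
        have h3 := hc _ S h1 h2
        obtain ⟨D, hD1, hD2, hD3, hD4⟩ := hml t
        by_cases h4 : a ∈ S <;> by_cases h5 : b ∈ S <;> simp only [h4, h5, if_true, if_false]
        · linarith
        · have h6 := hs S D
          have h7 := hc t.castSucc (S ∩ D) (by simp [h1, hD1]) (by simp [h2])
          have h8 := hcl (S ∪ D) (by simp [h4]) (by simp [h5, hD2])
          linarith
        · linarith
        · linarith)
      (by
        intro t t' htt
        obtain ⟨D, hD1, hD2, hD3, hD4⟩ := hml t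
        obtain ⟨E, hE1, hE2, hE3⟩ := hm t.castSucc t'.castSucc (by simpa using htt)
        refine ⟨E ∩ D, by simp [hE1, hD1], by simp [hE2], ?_⟩
        have h6 := hs E D
        have h7 := h0 (E ∪ D)
        have h8 := h0 (E ∩ D)
        simp only [mem_inter, hD2, hD3, and_false, if_false]
        linarith)
      S
    rw [Fin.sum_univ_castSucc]
    simp only [← ha, ← hb]
    linarith

/-- Minimal augmentation preserves the base polyhedron (single-term form of Appendix A):
if `z ∈ B(f)` for an integer-valued submodular `f` with `f(∅) = 0`, the pairs
`(i_t, j_t)` involve `2d` pairwise distinct elements, each arc has residual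
`h(S) = f(S) − z(S) ≥ 1` on every `S` with `i_t ∈ S ⊆ Q∖{j_t}`, and for `t < t'` there
is a shortcut-excluding set `S` with `i_t ∈ S ⊆ Q∖{j_{t'}}` and `h(S) = 0`, then
`ẑ = z + ∑_t (e_{i_t} − e_{j_t})` also lies in `B(f)`. -/
theorem minimal_augmentation_preserves_base {Q : Type*} [Fintype Q] [DecidableEq Q]
    (f : Finset Q → ℤ)
    (hsub : ∀ S T : Finset Q, f (S ∪ T) + f (S ∩ T) ≤ f S + f T)
    (hf0 : f ∅ = 0)
    (z : Q → ℤ)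
    (hzP : ∀ S : Finset Q, ∑ u ∈ S, z u ≤ f S)
    (hzB : ∑ u : Q, z u = f Finset.univ)
    (d : ℕ) (ii jj : Fin d → Q)
    (hii : Function.Injective ii) (hjj : Function.Injective jj)
    (hiijj : ∀ t t' : Fin d, ii t ≠ jj t')
    (hcap : ∀ t : Fin d, ∀ S : Finset Q, ii t ∈ S → jj t ∉ S → 1 ≤ f S - ∑ u ∈ S, z u)
    (hmin : ∀ t t' : Fin d, t < t' →
      ∃ S : Finset Q, ii t ∈ S ∧ jj t' ∉ S ∧ f S - ∑ u ∈ S, z u = 0) :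
    (∀ S : Finset Q,
      ∑ u ∈ S, (z u + ∑ t : Fin d,
        ((if ii t = u then (1 : ℤ) else 0) - if jj t = u then (1 : ℤ) else 0)) ≤ f S) ∧
    ∑ u : Q, (z u + ∑ t : Fin d,
        ((if ii t = u then (1 : ℤ) else 0) - if jj t = u then (1 : ℤ) else 0))
      = f Finset.univ := by
  have key := residual_augment d (fun S => f S - ∑ u ∈ S, z u)
    (by
      intro S T
      have h1 := hsub S T
      have h2 := Finset.sum_union_inter (s₁ := S) (s₂ := T) (f := z)
      linarith)
    (by intro S; have := hzP S; linarith) ii jj hcap hmin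
  have hsum : ∀ S : Finset Q, ∑ u ∈ S, (z u + ∑ t : Fin d,
        ((if ii t = u then (1 : ℤ) else 0) - if jj t = u then (1 : ℤ) else 0))
      = ∑ u ∈ S, z u + ∑ t : Fin d,
        ((if ii t ∈ S then (1 : ℤ) else 0) - if jj t ∈ S then (1 : ℤ) else 0) := by
    intro S
    rw [Finset.sum_add_distrib, Finset.sum_comm]
    congr 1
    refine Finset.sum_congr rfl fun t _ => ?_
    rw [Finset.sum_sub_distrib, Finset.sum_ite_eq, Finset.sum_ite_eq]
  constructor
  · intro S
    rw [hsum]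
    have := key S
    linarith
  · rw [hsum, ← hzB]
    simp
end

section
/- Proposition 5(a) (transitivity for cardinality-dependent terms): for any z ∈ ℝ^Q, any g : {0,…,m} → ℝ and any Δ > 0, the arc set Ā^Δ_Q is transitive: if i, i', i'' are pairwise distinct elements of Q with (i, i') ∈ Ā^Δ_Q and (i', i'') ∈ Ā^Δ_Q, then (i, i'') ∈ Ā^Δ_Q. -/
open Finset

/-- `topSum z k` is the sum of the `k` largest components of `z`
(`= max { z(S) : |S| = k }`, whenever `k ≤ |Q|`). -/
noncomputable def topSum {Q : Type*} [Fintype Q] (z : Q → ℝ) (k : ℕ) : ℝ :=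
  letI := Classical.decEq ℝ
  ((((Finset.univ : Finset Q).powersetCard k).image fun S => ∑ i ∈ S, z i).max).getD 0

/-- `Lval z i = L(i)`: the first (1-based) position of value `z i` in the
non-increasing ordering of the components of `z`. -/
noncomputable def Lval {Q : Type*} [Fintype Q] (z : Q → ℝ) (i : Q) : ℕ :=
  letI : DecidablePred fun j : Q => z i < z j := fun _ => Classical.dec _
  ((Finset.univ : Finset Q).filter fun j => z i < z j).card + 1

/-- `Rval z i = R(i)`: the last (1-based) position of value `z i` in the
non-increasing ordering of the components of `z`. -/
noncomputable def Rval {Q : Type*} [Fintype Q] (z : Q → ℝ) (i : Q) : ℕ :=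
  letI : DecidablePred fun j : Q => z i ≤ z j := fun _ => Classical.dec _
  ((Finset.univ : Finset Q).filter fun j => z i ≤ z j).card

/-- The residual function `ḡ(k) = g(k) − ∑_{k'=1}^{k} z^{k'}`. -/
noncomputable def resid {Q : Type*} [Fintype Q] (g : ℕ → ℝ) (z : Q → ℝ) (k : ℕ) : ℝ :=
  g k - topSum z k

/-- The arc set `Ā^Δ_Q`: `(i,j)` with `i ≠ j` such that either `z_i < z_j`, or
`z_i ≥ z_j` and `min_{k ∈ {L(i),…,R(j)−1}} ḡ(k) ≥ 3Δ/2`. -/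
def ArcD {Q : Type*} [Fintype Q] (g : ℕ → ℝ) (z : Q → ℝ) (Δ : ℝ) (i j : Q) : Prop :=
  i ≠ j ∧ (z i < z j ∨ (z j ≤ z i ∧
    ∀ k : ℕ, Lval z i ≤ k → k < Rval z j → 3 * Δ / 2 ≤ resid g z k))

theorem Lval_anti {Q : Type*} [Fintype Q] (z : Q → ℝ) {i j : Q} (h : z i ≤ z j) :
    Lval z j ≤ Lval z i := by
  classical
  unfold Lval
  refine Nat.succ_le_succ (Finset.card_le_card ?_)
  intro a ha
  simp only [Finset.mem_filter, Finset.mem_univ, true_and] at ha ⊢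
  exact lt_of_le_of_lt h ha

theorem Rval_anti {Q : Type*} [Fintype Q] (z : Q → ℝ) {i j : Q} (h : z i ≤ z j) :
    Rval z j ≤ Rval z i := by
  classical
  unfold Rval
  refine Finset.card_le_card ?_
  intro a ha
  simp only [Finset.mem_filter, Finset.mem_univ, true_and] at ha ⊢
  exact le_trans h ha

theorem Lval_le_Rval {Q : Type*} [Fintype Q] (z : Q → ℝ) (i : Q) :
    Lval z i ≤ Rval z i := by
  classical
  unfold Lval Rval
  refine Nat.succ_le_of_lt (Finset.card_lt_card ?_)
  rw [Finset.ssubset_iff_of_subset]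
  · exact ⟨i, by simp, by simp⟩
  · intro a ha
    simp only [Finset.mem_filter, Finset.mem_univ, true_and] at ha ⊢
    exact le_of_lt ha

/-- Proposition 5(a): for any `z`, `g` and `Δ > 0`, the arc set `Ā^Δ_Q` is transitive. -/
theorem cardinality_arcs_transitive {Q : Type*} [Fintype Q] [DecidableEq Q]
    (hm : 2 ≤ Fintype.card Q)
    (g : ℕ → ℝ) (z : Q → ℝ) (Δ : ℝ) (hΔ : 0 < Δ)
    (i i' i'' : Q) (h1 : i ≠ i') (h2 : i' ≠ i'') (h3 : i ≠ i'')
    (ha1 : ArcD g z Δ i i') (ha2 : ArcD g z Δ i' i'') :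
    ArcD g z Δ i i'' := by
  refine ⟨h3, ?_⟩
  rcases lt_or_ge (z i) (z i'') with h | h
  · exact Or.inl h
  refine Or.inr ⟨h, fun k hk1 hk2 => ?_⟩
  rcases ha1.2 with a | ⟨a, a'⟩
  · rcases ha2.2 with b | ⟨b, b'⟩
    · linarith
    · exact b' k ((Lval_anti z a.le).trans hk1) hk2
  · rcases ha2.2 with b | ⟨b, b'⟩
    · exact a' k hk1 (lt_of_lt_of_le hk2 (Rval_anti z b.le))
    · rcases lt_or_ge k (Rval z i') with c | c
      · exact a' k hk1 c
      · exact b' k ((Lval_le_Rval z i').trans c) hk2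
end

section
/- Proposition 5(c) (phase-gap bound for cardinality-dependent terms): let Δ > 0, let g : {0,…,m} → ℝ be concave, and let z ∈ ℝ^Q satisfy ḡ(k) ≥ 0 for all k ∈ {0,…,m} and ḡ(m) = 0. Let S be a nonempty proper subset of Q, let i ∈ S be an element minimizing z over S, and let j ∈ Q∖S be an element maximizing z over Q∖S. Suppose z_i ≥ z_j and there exists k̄ ∈ {L(i), …, R(j)−1} with ḡ(k̄) ≤ ⌊3Δ⌋. Then g(|S|) − z(S) = ḡ(|S|) ≤ 3(m−1)·⌈Δ⌉. -/
open Finset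

theorem aux_topSum_eq {Q : Type*} [Fintype Q] (z : Q → ℝ) (T : Finset Q)
    (hT : ∀ u ∈ T, ∀ v, v ∉ T → z v ≤ z u) : topSum z T.card = ∑ u ∈ T, z u := by
  classical
  have key : ∀ U : Finset Q, U.card = T.card → ∑ u ∈ U, z u ≤ ∑ u ∈ T, z u := by
    intro U hU
    have h1 : ∑ u ∈ U \ T, z u ≤ ∑ u ∈ T \ U, z u := by
      have hc : (U \ T).card = (T \ U).card := by
        have e1 := Finset.card_sdiff_add_card_inter U T
        have e2 := Finset.card_sdiff_add_card_inter T U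
        rw [Finset.inter_comm] at e2
        omega
      have e : (U \ T : Finset Q) ≃ (T \ U : Finset Q) := Finset.equivOfCardEq hc
      rw [← Finset.sum_coe_sort (U \ T), ← Finset.sum_coe_sort (T \ U), ← Equiv.sum_comp e]
      refine Finset.sum_le_sum fun x _ => ?_
      have hx := Finset.mem_sdiff.1 x.2
      have hy := Finset.mem_sdiff.1 (e x).2
      exact hT _ hy.1 _ hx.2
    have e1 := Finset.sum_inter_add_sum_sdiff U T z
    have e2 := Finset.sum_inter_add_sum_sdiff T U z
    rw [Finset.inter_comm] at e2
    linarith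
  unfold topSum
  have hmax : (((Finset.univ : Finset Q).powersetCard T.card).image
      fun S => ∑ i ∈ S, z i).max = ((∑ u ∈ T, z u : ℝ) : WithBot ℝ) := by
    apply le_antisymm
    · apply Finset.max_le
      intro a ha
      simp only [Finset.mem_image, Finset.mem_powersetCard] at ha
      obtain ⟨U, hU, rfl⟩ := ha
      exact WithBot.coe_le_coe.2 (key U hU.2)
    · apply Finset.le_max
      simp only [Finset.mem_image, Finset.mem_powersetCard]
      exact ⟨T, ⟨Finset.subset_univ _, rfl⟩, rfl⟩
  have : (letI := Classical.decEq ℝ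
    (((Finset.univ : Finset Q).powersetCard T.card).image
      fun S => ∑ i ∈ S, z i).max) = ((∑ u ∈ T, z u : ℝ) : WithBot ℝ) := by
    convert hmax
  simp only at this
  rw [this]
  rfl

theorem aux_conc (g : ℕ → ℝ) (m : ℕ)
    (hconc : ∀ k : ℕ, k + 2 ≤ m → g (k + 2) - g (k + 1) ≤ g (k + 1) - g k)
    (a p q : ℕ) (h : a + p + q ≤ m) :
    (q : ℝ) * g a + p * g (a + p + q) ≤ (p + q) * g (a + p) := by
  rcases Nat.eq_zero_or_pos q with rfl | hq
  · simp
  have hanti : ∀ k n : ℕ, k + n + 1 ≤ m → g (k + n + 1) - g (k + n) ≤ g (k + 1) - g k := by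
    intro k n
    induction n with
    | zero => intro _; simp
    | succ n ih =>
      intro hn
      have h1 := ih (by omega)
      have h2 := hconc (k + n) (by omega)
      have e : k + (n + 1) + 1 = k + n + 2 := by ring
      have e' : k + (n + 1) = k + n + 1 := by ring
      rw [e, e']
      linarith
  set d := g (a + p + 1) - g (a + p) with hd
  have hup : ∀ n, a + p + n ≤ m → g (a + p + n) - g (a + p) ≤ n * d := by
    intro n
    induction n with
    | zero => intro _; simp
    | succ n ih =>
      intro hn
      have h1 := ih (by omega)
      have h2 := hanti (a + p) n (by omega)
      rw [← add_assoc]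
      push_cast
      linarith
  have hlo : ∀ n, n ≤ p → (n : ℝ) * d ≤ g (a + n) - g a := by
    intro n
    induction n with
    | zero => intro _; simp
    | succ n ih =>
      intro hn
      have h1 := ih (by omega)
      have h2 := hanti (a + n) (p - n) (by omega)
      have e : a + n + (p - n) = a + p := by omega
      rw [e] at h2
      rw [← add_assoc]
      push_cast
      linarith
  have h1 := mul_le_mul_of_nonneg_left (hup q h) (Nat.cast_nonneg (α := ℝ) p)
  have h2 := mul_le_mul_of_nonneg_left (hlo p le_rfl) (Nat.cast_nonneg (α := ℝ) q)
  nlinarith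

/-- Proposition 5(c) (phase-gap bound): if `S` is a nonempty proper subset, `i ∈ S`
minimizes `z` on `S`, `j ∉ S` maximizes `z` off `S`, `z_i ≥ z_j`, and some
`k̄ ∈ {L(i),…,R(j)−1}` has `ḡ(k̄) ≤ ⌊3Δ⌋`, then
`g(|S|) − z(S) = ḡ(|S|) ≤ 3(m−1)⌈Δ⌉`. -/
theorem cardinality_phase_gap {Q : Type*} [Fintype Q] [DecidableEq Q]
    (hm : 2 ≤ Fintype.card Q)
    (Δ : ℝ) (hΔ : 0 < Δ) (g : ℕ → ℝ)
    (hconc : ∀ k : ℕ, k + 2 ≤ Fintype.card Q → g (k + 2) - g (k + 1) ≤ g (k + 1) - g k)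
    (z : Q → ℝ)
    (hres : ∀ k ≤ Fintype.card Q, 0 ≤ resid g z k)
    (hresm : resid g z (Fintype.card Q) = 0)
    (S : Finset Q) (hSne : S.Nonempty) (hSproper : S ≠ Finset.univ)
    (i : Q) (hiS : i ∈ S) (himin : ∀ u ∈ S, z i ≤ z u)
    (j : Q) (hjS : j ∉ S) (hjmax : ∀ u ∉ S, z u ≤ z j)
    (hij : z j ≤ z i)
    (hkbar : ∃ kbar : ℕ, Lval z i ≤ kbar ∧ kbar < Rval z j ∧
      resid g z kbar ≤ (⌊3 * Δ⌋ : ℝ)) :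
    g S.card - ∑ u ∈ S, z u = resid g z S.card ∧
    resid g z S.card ≤ 3 * ((Fintype.card Q : ℝ) - 1) * (⌈Δ⌉ : ℝ) := by
  classical
  have hthr : ∀ u ∈ S, ∀ v, v ∉ S → z v ≤ z u := fun u hu v hv =>
    (hjmax v hv).trans (hij.trans (himin u hu))
  have htS := aux_topSum_eq z S hthr
  refine ⟨by rw [resid, htS], ?_⟩
  obtain ⟨k, hLk, hkR, hk⟩ := hkbar
  have hfl : (⌊3 * Δ⌋ : ℝ) ≤ 3 * (⌈Δ⌉ : ℝ) := by
    have h1 := Int.floor_le (3 * Δ)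
    have h2 := Int.le_ceil Δ
    linarith
  have hsm : S.card < Fintype.card Q := by
    rw [← Finset.card_univ]
    exact Finset.card_lt_card (Finset.ssubset_univ_iff.2 hSproper)
  have hspos : 0 < S.card := hSne.card_pos
  have hcpos : (0 : ℝ) ≤ 3 * (⌈Δ⌉ : ℝ) := by
    have h2 := Int.le_ceil Δ
    linarith
  -- the common final step
  have fin : ∀ (n p : ℕ), 1 ≤ p → n + 1 ≤ Fintype.card Q →
      (p : ℝ) * resid g z S.card ≤ n * resid g z k →
      resid g z S.card ≤ 3 * ((Fintype.card Q : ℝ) - 1) * (⌈Δ⌉ : ℝ) := by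
    intro n p hp hn h
    have h0 := hres S.card hsm.le
    have hp' : (1 : ℝ) ≤ p := by exact_mod_cast hp
    have hn' : (n : ℝ) + 1 ≤ Fintype.card Q := by exact_mod_cast hn
    have h1 : resid g z S.card ≤ p * resid g z S.card := le_mul_of_one_le_left h0 hp'
    have h2 : (n : ℝ) * resid g z k ≤ n * (3 * (⌈Δ⌉ : ℝ)) :=
      mul_le_mul_of_nonneg_left (hk.trans hfl) (Nat.cast_nonneg n)
    have h3 : (n : ℝ) * (3 * (⌈Δ⌉ : ℝ)) ≤ ((Fintype.card Q : ℝ) - 1) * (3 * (⌈Δ⌉ : ℝ)) :=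
      mul_le_mul_of_nonneg_right (by linarith) hcpos
    linarith
  have hL : Lval z i = (Finset.univ.filter fun v => z i < z v).card + 1 := by
    unfold Lval; congr!
  have hR : Rval z j = (Finset.univ.filter fun v => z j ≤ z v).card := by
    unfold Rval; congr!
  set A := Finset.univ.filter fun v => z i < z v with hA
  set B := Finset.univ.filter fun v => z j ≤ z v with hB
  have hAS : A ⊆ S := by
    intro v hv
    by_contra hvS
    have h1 := (Finset.mem_filter.1 hv).2
    have h2 := hjmax v hvS
    linarith
  have hSB : S ⊆ B := by
    intro v hv
    exact Finset.mem_filter.2 ⟨Finset.mem_univ _, hij.trans (himin v hv)⟩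
  have hBm : B.card ≤ Fintype.card Q := Finset.card_le_univ B
  have hlow : ∀ n, A.card ≤ n → n ≤ S.card →
      topSum z n = topSum z S.card - ((S.card : ℝ) - n) * z i := by
    intro n h1 h2
    obtain ⟨T, hAT, hTS, rfl⟩ := Finset.exists_subsuperset_card_eq hAS h1 h2
    rw [htS, aux_topSum_eq z T, ← Finset.sum_sdiff hTS]
    · have : ∑ u ∈ S \ T, z u = ∑ u ∈ S \ T, z i := by
        refine Finset.sum_congr rfl fun u hu => ?_
        obtain ⟨huS, huT⟩ := Finset.mem_sdiff.1 hu
        refine le_antisymm (not_lt.1 fun h => huT (hAT ?_)) (himin u huS)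
        exact Finset.mem_filter.2 ⟨Finset.mem_univ _, h⟩
      rw [this, Finset.sum_const, Finset.card_sdiff_of_subset hTS, nsmul_eq_mul,
        Nat.cast_sub h2]
      ring
    · intro u hu v hv
      refine le_trans (not_lt.1 fun h => hv (hAT ?_)) (himin u (hTS hu))
      exact Finset.mem_filter.2 ⟨Finset.mem_univ _, h⟩
  have hhigh : ∀ n, S.card ≤ n → n ≤ B.card →
      topSum z n = topSum z S.card + ((n : ℝ) - S.card) * z j := by
    intro n h1 h2
    obtain ⟨T, hST, hTB, rfl⟩ := Finset.exists_subsuperset_card_eq hSB h1 h2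
    rw [htS, aux_topSum_eq z T, ← Finset.sum_sdiff hST]
    · have : ∑ u ∈ T \ S, z u = ∑ u ∈ T \ S, z j := by
        refine Finset.sum_congr rfl fun u hu => ?_
        obtain ⟨huT, huS⟩ := Finset.mem_sdiff.1 hu
        exact le_antisymm (hjmax u huS) (Finset.mem_filter.1 (hTB huT)).2
      rw [this, Finset.sum_const, Finset.card_sdiff_of_subset hST, nsmul_eq_mul,
        Nat.cast_sub h1]
      ring
    · intro u hu v hv
      exact (hjmax v fun h => hv (hST h)).trans (Finset.mem_filter.1 (hTB hu)).2
  rcases le_total k S.card with hks | hsk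
  · obtain ⟨p, hp⟩ := Nat.exists_eq_add_of_le (show A.card ≤ k by omega)
    obtain ⟨q, hq⟩ := Nat.exists_eq_add_of_le hks
    have hc := aux_conc g (Fintype.card Q) hconc A.card p q (by omega)
    rw [← hp, ← hq] at hc
    refine fin (p + q) p (by omega) (by omega) ?_
    have ha := hres A.card (by omega)
    have ha' := mul_nonneg (Nat.cast_nonneg (α := ℝ) q) ha
    have t1 := hlow A.card le_rfl (by omega)
    have t2 := hlow k (by omega) hks
    have c1 : (k : ℝ) = A.card + p := by exact_mod_cast hp
    have c2 : (S.card : ℝ) = k + q := by exact_mod_cast hq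
    unfold resid at ha' ⊢
    rw [t1] at ha'
    rw [t2]
    rw [c2, c1] at ha' ⊢
    push_cast
    nlinarith
  · obtain ⟨p, hp⟩ := Nat.exists_eq_add_of_le hsk
    obtain ⟨q, hq⟩ := Nat.exists_eq_add_of_le (show k ≤ B.card by omega)
    have hc := aux_conc g (Fintype.card Q) hconc S.card p q (by omega)
    rw [← hp, ← hq] at hc
    refine fin (p + q) q (by omega) (by omega) ?_
    have ha := hres B.card (by omega)
    have ha' := mul_nonneg (Nat.cast_nonneg (α := ℝ) p) ha
    have t1 := hhigh B.card (by omega) le_rfl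
    have t2 := hhigh k hsk (by omega)
    have c1 : (k : ℝ) = S.card + p := by exact_mod_cast hp
    have c2 : (B.card : ℝ) = k + q := by exact_mod_cast hq
    unfold resid at ha' ⊢
    rw [t1] at ha'
    rw [t2]
    rw [c2, c1] at ha'
    rw [c1]
    push_cast
    nlinarith
end

section
/- Exact effect of a transfer with z_i ≥ z_j on sorted prefix sums: let Q be a finite set with m = |Q|, let δ > 0, and let z ∈ ℝ^Q have every component an integer multiple of δ. Let i ≠ j with z_i ≥ z_j, and define ẑ by ẑ_i = z_i + δ, ẑ_j = z_j − δ, and ẑ_u = z_u otherwise. Then for every k ∈ {0,…,m}: if k ∈ {L(i), …, R(j)−1} then the sum of the k largest components of ẑ equals the sum of the k largest components of z plus δ, and for all other k the two sums are equal. Equivalently, ĝ(k) = ḡ(k) − δ for k ∈ {L(i),…,R(j)−1} and ĝ(k) = ḡ(k) otherwise, where ĝ is the residual function of ẑ. -/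
open Finset

theorem topSum_ge_aux {Q : Type*} [Fintype Q] (z : Q → ℝ) (S : Finset Q) :
    ∑ u ∈ S, z u ≤ topSum z S.card := by
  classical
  unfold topSum
  have hmem : (∑ u ∈ S, z u) ∈
      (((Finset.univ : Finset Q).powersetCard S.card).image fun S => ∑ i ∈ S, z i) :=
    Finset.mem_image.2 ⟨S, Finset.mem_powersetCard.2 ⟨Finset.subset_univ _, rfl⟩, rfl⟩
  obtain ⟨b, hb⟩ := Finset.max_of_mem hmem
  have h2 := Finset.le_max_of_eq hmem hb
  refine le_of_le_of_eq h2 (Eq.symm ?_)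
  have : ∀ x : WithBot ℝ, x = (b : WithBot ℝ) → Option.getD x 0 = b := by
    rintro x rfl; rfl
  apply this
  convert hb

theorem topSum_attained_aux {Q : Type*} [Fintype Q] (z : Q → ℝ) (k : ℕ)
    (hk : k ≤ Fintype.card Q) :
    ∃ S : Finset Q, S.card = k ∧ ∑ u ∈ S, z u = topSum z k := by
  classical
  unfold topSum
  obtain ⟨T, hT, hTk⟩ := Finset.exists_subset_card_eq (s := (Finset.univ : Finset Q)) hk
  have hmem : (∑ u ∈ T, z u) ∈
      (((Finset.univ : Finset Q).powersetCard k).image fun S => ∑ i ∈ S, z i) :=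
    Finset.mem_image.2 ⟨T, Finset.mem_powersetCard.2 ⟨Finset.subset_univ _, hTk⟩, rfl⟩
  obtain ⟨b, hb⟩ := Finset.max_of_mem hmem
  obtain ⟨S, hS, hSb⟩ := Finset.mem_image.1 (Finset.mem_of_max hb)
  refine ⟨S, (Finset.mem_powersetCard.1 hS).2, ?_⟩
  have : ∀ x : WithBot ℝ, x = (b : WithBot ℝ) → b = Option.getD x 0 := by
    rintro x rfl; rfl
  rw [hSb]
  apply this
  convert hb

theorem swap_aux {Q : Type*} [DecidableEq Q] (z : Q → ℝ) (S : Finset Q) (u v : Q)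
    (hu : u ∈ S) (hv : v ∉ S) :
    (insert v (S.erase u)).card = S.card ∧
      ∑ w ∈ insert v (S.erase u), z w = ∑ w ∈ S, z w - z u + z v := by
  have hv' : v ∉ S.erase u := fun h => hv (Finset.mem_of_mem_erase h)
  constructor
  · rw [Finset.card_insert_of_notMem hv', Finset.card_erase_add_one hu]
  · rw [Finset.sum_insert hv', ← Finset.add_sum_erase S z hu]
    ring

theorem sum_transfer_aux {Q : Type*} [DecidableEq Q] (z : Q → ℝ) (δ : ℝ) (i j : Q)
    (hij : i ≠ j) (S : Finset Q) :
    ∑ u ∈ S, (if u = i then z i + δ else if u = j then z j - δ else z u)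
      = ∑ u ∈ S, z u + (if i ∈ S then δ else 0) - (if j ∈ S then δ else 0) := by
  have h : ∀ u, (if u = i then z i + δ else if u = j then z j - δ else z u)
      = z u + (if u = i then δ else 0) - (if u = j then δ else 0) := by
    intro u
    by_cases h1 : u = i
    · subst h1; simp [hij]
    · by_cases h2 : u = j
      · subst h2; simp [h1]
      · simp [h1, h2]
  simp only [h, Finset.sum_sub_distrib, Finset.sum_add_distrib, Finset.sum_ite_eq']

theorem mult_gap_aux {δ x y : ℝ} (hδ : 0 < δ) (hx : ∃ a : ℤ, x = a * δ)
    (hy : ∃ a : ℤ, y = a * δ) (h : x < y) : x + δ ≤ y := by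
  obtain ⟨a, rfl⟩ := hx
  obtain ⟨b, rfl⟩ := hy
  have h1 : (a : ℝ) < b := lt_of_mul_lt_mul_right h hδ.le
  have h2 : (a : ℝ) + 1 ≤ b := by exact_mod_cast h1
  nlinarith

theorem transfer_main_aux {Q : Type*} [Fintype Q] [DecidableEq Q]
    (δ : ℝ) (hδ : 0 < δ)
    (z : Q → ℝ) (hmult : ∀ u : Q, ∃ a : ℤ, z u = a * δ)
    (i j : Q) (hij : i ≠ j) (hz : z j ≤ z i) (k : ℕ) (hk : k ≤ Fintype.card Q) :
      ((Lval z i ≤ k ∧ k < Rval z j) →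
        topSum (fun u => if u = i then z i + δ else if u = j then z j - δ else z u) k
          = topSum z k + δ) ∧
      (¬ (Lval z i ≤ k ∧ k < Rval z j) →
        topSum (fun u => if u = i then z i + δ else if u = j then z j - δ else z u) k
          = topSum z k) := by
  set y : Q → ℝ := fun u => if u = i then z i + δ else if u = j then z j - δ else z u with hy
  have hsum : ∀ S : Finset Q, ∑ u ∈ S, y u
      = ∑ u ∈ S, z u + (if i ∈ S then δ else 0) - (if j ∈ S then δ else 0) :=
    sum_transfer_aux z δ i j hij
  have hge : ∀ (w : Q → ℝ) (S : Finset Q), S.card = k → ∑ u ∈ S, w u ≤ topSum w k := by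
    rintro w S rfl; exact topSum_ge_aux w S
  obtain ⟨A, hAk, hA⟩ := topSum_attained_aux z k hk
  obtain ⟨B, hBk, hB⟩ := topSum_attained_aux y k hk
  have hBs := hsum B
  have hBz := hge z B hBk
  constructor
  · rintro ⟨hL, hR⟩
    apply le_antisymm
    · split_ifs at hBs <;> linarith
    · obtain ⟨S, hSk, hS, hiS⟩ : ∃ S : Finset Q, S.card = k ∧
          topSum z k ≤ ∑ u ∈ S, z u ∧ i ∈ S := by
        by_cases hiA : i ∈ A
        · exact ⟨A, hAk, hA.ge, hiA⟩
        · obtain ⟨u, hu, hzu⟩ : ∃ u ∈ A, z u ≤ z i := by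
            by_contra! hcon
            unfold Lval at hL
            have := Finset.card_le_card (fun u hu => Finset.mem_filter.2
              ⟨Finset.mem_univ u, hcon u hu⟩ : A ⊆ Finset.univ.filter fun u => z i < z u)
            grind
          obtain ⟨h1, h2⟩ := swap_aux z A u i hu hiA
          exact ⟨_, h1.trans hAk, by linarith, Finset.mem_insert_self _ _⟩
      obtain ⟨T, hTk, hT, hiT, hjT⟩ : ∃ T : Finset Q, T.card = k ∧
          topSum z k ≤ ∑ u ∈ T, z u ∧ i ∈ T ∧ j ∉ T := by
        by_cases hjS : j ∈ S
        · obtain ⟨v, hv, hzv⟩ : ∃ v, v ∉ S ∧ z j ≤ z v := by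
            by_contra! hcon
            unfold Rval at hR
            have : (Finset.univ.filter fun u => z j ≤ z u) ⊆ S := by
              intro u hu
              by_contra hn
              exact absurd (hcon u hn) (not_lt.2 (Finset.mem_filter.1 hu).2)
            have := Finset.card_le_card this
            grind
          obtain ⟨h1, h2⟩ := swap_aux z S j v hjS hv
          exact ⟨_, h1.trans hSk, by linarith, by grind, by grind⟩
        · exact ⟨S, hSk, hS, hiS, hjS⟩
      have h1 := hsum T
      have h2 := hge y T hTk
      rw [if_pos hiT, if_neg hjT] at h1
      linarith
  · intro hn
    apply le_antisymm
    · by_cases hc : i ∈ B ∧ j ∉ B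
      · obtain ⟨hiB, hjB⟩ := hc
        rw [if_pos hiB, if_neg hjB] at hBs
        by_cases hL : Lval z i ≤ k
        · have hR : Rval z j ≤ k := by
            by_contra! h
            exact hn ⟨hL, h⟩
          obtain ⟨u, hu, hzu⟩ : ∃ u ∈ B, z u < z j := by
            by_contra! hcon
            unfold Rval at hR
            have hsub : insert j B ⊆ Finset.univ.filter fun u => z j ≤ z u := by
              intro u hu
              rcases Finset.mem_insert.1 hu with rfl | hu
              · simp
              · simp [hcon u hu]
            have := Finset.card_le_card hsub
            rw [Finset.card_insert_of_notMem hjB] at this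
            grind
          obtain ⟨h1, h2⟩ := swap_aux z B u j hu hjB
          have h3 := hge z _ (h1.trans hBk)
          have h4 := mult_gap_aux hδ (hmult u) (hmult j) hzu
          linarith
        · obtain ⟨v, hv, hzv⟩ : ∃ v, v ∉ B ∧ z i < z v := by
            by_contra! hcon
            unfold Lval at hL
            have hsub : (Finset.univ.filter fun u => z i < z u) ⊆ B.erase i := by
              intro u hu
              have hu' := (Finset.mem_filter.1 hu).2
              refine Finset.mem_erase.2 ⟨?_, ?_⟩
              · rintro rfl; exact lt_irrefl _ hu'
              · by_contra hn
                exact absurd (hcon u hn) (not_le.2 hu')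
            have := Finset.card_le_card hsub
            have := Finset.card_erase_add_one hiB
            grind
          obtain ⟨h1, h2⟩ := swap_aux z B i v hiB hv
          have h3 := hge z _ (h1.trans hBk)
          have h4 := mult_gap_aux hδ (hmult i) (hmult v) hzv
          linarith
      · split_ifs at hBs <;> first | linarith | tauto
    · by_cases hc : j ∈ A ∧ i ∉ A
      · obtain ⟨h1, h2⟩ := swap_aux z A j i hc.1 hc.2
        have h3 := hge y _ (h1.trans hAk)
        have h4 := hsum (insert i (A.erase j))
        rw [if_pos (Finset.mem_insert_self _ _), if_neg (by grind)] at h4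
        linarith
      · have h3 := hge y A hAk
        have h4 := hsum A
        split_ifs at h4 <;> first | linarith | tauto

/-- Exact effect of a transfer with `z_i ≥ z_j` on sorted prefix sums: if all
components of `z` are integer multiples of `δ > 0` and `δ` is moved from `j` to `i`,
then the top-`k` sum increases by exactly `δ` for `k ∈ {L(i),…,R(j)−1}` and is
unchanged for all other `k ∈ {0,…,m}`; equivalently `ĝ(k) = ḡ(k) − δ` on that range
and `ĝ(k) = ḡ(k)` elsewhere. -/
theorem transfer_effect_on_prefix_sums {Q : Type*} [Fintype Q] [DecidableEq Q]
    (hm : 2 ≤ Fintype.card Q)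
    (δ : ℝ) (hδ : 0 < δ)
    (z : Q → ℝ) (hmult : ∀ u : Q, ∃ a : ℤ, z u = a * δ)
    (i j : Q) (hij : i ≠ j) (hz : z j ≤ z i) :
    ∀ k ≤ Fintype.card Q,
      ((Lval z i ≤ k ∧ k < Rval z j) →
        topSum (fun u => if u = i then z i + δ else if u = j then z j - δ else z u) k
          = topSum z k + δ) ∧
      (¬ (Lval z i ≤ k ∧ k < Rval z j) →
        topSum (fun u => if u = i then z i + δ else if u = j then z j - δ else z u) k
          = topSum z k) ∧
      ∀ g : ℕ → ℝ,
        ((Lval z i ≤ k ∧ k < Rval z j) →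
          resid g (fun u => if u = i then z i + δ else if u = j then z j - δ else z u) k
            = resid g z k - δ) ∧
        (¬ (Lval z i ≤ k ∧ k < Rval z j) →
          resid g (fun u => if u = i then z i + δ else if u = j then z j - δ else z u) k
            = resid g z k) := by
  intro k hk
  obtain ⟨h1, h2⟩ := transfer_main_aux δ hδ z hmult i j hij hz k hk
  refine ⟨h1, h2, fun g => ⟨fun h => ?_, fun h => ?_⟩⟩
  · unfold resid
    rw [h1 h]
    ring
  · unfold resid
    rw [h2 h]
end

section
/- Scaled function inequality and membership in the smaller submodular polyhedron: let Q be a finite set with m = |Q|, let f : 2^Q → ℝ with f(∅) = 0, and let Δ = 2^l for an integer l ≥ −1. Define f^Δ(S) = Δ·⌊f(S)/Δ⌋ + ⌊Δ⌋·|S|·|Q∖S|. Then for every S ⊆ Q: f^{2Δ}(S) − m·⌈Δ⌉·|S| ≤ f^Δ(S). Consequently, if φ° ∈ ℝ^Q satisfies φ°(S) ≤ f^{2Δ}(S) for all S ⊆ Q, then the vector φ' defined by φ'_i = φ°_i − m·⌈Δ⌉ satisfies φ'(S) ≤ f^Δ(S) for all S ⊆ Q, i.e. φ' lies in the submodular polyhedron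 P(f^Δ) = { φ ∈ ℝ^Q : φ(S) ≤ f^Δ(S) ∀ S ⊆ Q }. -/
open Finset

/-- Iwata's scaled approximation `f^Δ(S) = Δ·⌊f(S)/Δ⌋ + ⌊Δ⌋·|S|·|Q∖S|`. -/
noncomputable def scaledFn {Q : Type*} [Fintype Q] [DecidableEq Q]
    (Δ : ℝ) (f : Finset Q → ℝ) (S : Finset Q) : ℝ :=
  Δ * (⌊f S / Δ⌋ : ℝ) + (⌊Δ⌋ : ℝ) * ((S.card : ℝ) * (Sᶜ.card : ℝ))

/-- Scaled function inequality and membership in the smaller submodular polyhedron: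
for `Δ = 2^l`, `l ≥ −1`, one has `f^{2Δ}(S) − m⌈Δ⌉|S| ≤ f^Δ(S)` for every `S`;
consequently if `φ°(S) ≤ f^{2Δ}(S)` for all `S`, then `φ' = φ° − m⌈Δ⌉·𝟙` lies in the
submodular polyhedron `P(f^Δ)`. -/
theorem scaled_polyhedron_shift {Q : Type*} [Fintype Q] [DecidableEq Q]
    (f : Finset Q → ℝ) (hf0 : f ∅ = 0)
    (l : ℤ) (hl : -1 ≤ l) (Δ : ℝ) (hΔ : Δ = (2 : ℝ) ^ l) :
    (∀ S : Finset Q,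
      scaledFn (2 * Δ) f S - (Fintype.card Q : ℝ) * (⌈Δ⌉ : ℝ) * (S.card : ℝ)
        ≤ scaledFn Δ f S) ∧
    ∀ φ : Q → ℝ, (∀ S : Finset Q, ∑ u ∈ S, φ u ≤ scaledFn (2 * Δ) f S) →
      ∀ S : Finset Q,
        ∑ u ∈ S, (φ u - (Fintype.card Q : ℝ) * (⌈Δ⌉ : ℝ)) ≤ scaledFn Δ f S := by
  have hpos : 0 < Δ := by rw [hΔ]; positivity
  have key : ∀ S : Finset Q,
      scaledFn (2 * Δ) f S - (Fintype.card Q : ℝ) * (⌈Δ⌉ : ℝ) * (S.card : ℝ)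
        ≤ scaledFn Δ f S := by
    intro S
    unfold scaledFn
    have h1 : 2 * ⌊f S / (2 * Δ)⌋ ≤ ⌊f S / Δ⌋ := by
      rw [Int.le_floor]
      push_cast
      have h := Int.floor_le (f S / (2 * Δ))
      have e : f S / Δ = 2 * (f S / (2 * Δ)) := by field_simp
      linarith
    have h1' : 2 * (⌊f S / (2 * Δ)⌋ : ℝ) ≤ ⌊f S / Δ⌋ := by exact_mod_cast h1
    have h2 : ⌊2 * Δ⌋ ≤ ⌊Δ⌋ + ⌈Δ⌉ := by
      rw [← Int.lt_add_one_iff, Int.floor_lt]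
      push_cast
      linarith [Int.lt_floor_add_one Δ, Int.le_ceil Δ]
    have h2' : (⌊2 * Δ⌋ : ℝ) ≤ ⌊Δ⌋ + ⌈Δ⌉ := by exact_mod_cast h2
    have h3 : (Sᶜ.card : ℝ) ≤ Fintype.card Q := by exact_mod_cast Finset.card_le_univ _
    have hc : (0 : ℝ) ≤ ⌈Δ⌉ := hpos.le.trans (Int.le_ceil Δ)
    have hs : (0 : ℝ) ≤ S.card := Nat.cast_nonneg _
    have hs' : (0 : ℝ) ≤ Sᶜ.card := Nat.cast_nonneg _
    have a := mul_le_mul_of_nonneg_left h1' hpos.le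
    have b := mul_le_mul_of_nonneg_right h2' (mul_nonneg hs hs')
    have c := mul_le_mul_of_nonneg_left h3 (mul_nonneg hc hs)
    linarith
  refine ⟨key, fun φ hφ S => ?_⟩
  rw [Finset.sum_sub_distrib, Finset.sum_const, nsmul_eq_mul]
  linarith [key S, hφ S]
end

section
/- Scaled-function approximation bound: let Q be a finite set, f : 2^Q → ℝ, and Δ = 2^l for an integer l ≥ −1. Define f^Δ(S) = Δ·⌊f(S)/Δ⌋ + ⌊Δ⌋·|S|·|Q∖S|. Then for every S ⊆ Q: |f^{2Δ}(S) − f^Δ(S)| ≤ (2 + |S|·|Q∖S|)·⌈Δ⌉. -/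
open Finset

/-- Scaled-function approximation bound: for `Δ = 2^l`, `l ≥ −1`,
`|f^{2Δ}(S) − f^Δ(S)| ≤ (2 + |S|·|Q∖S|)·⌈Δ⌉` for every `S ⊆ Q`. -/
theorem scaled_approximation_bound {Q : Type*} [Fintype Q] [DecidableEq Q]
    (f : Finset Q → ℝ)
    (l : ℤ) (hl : -1 ≤ l) (Δ : ℝ) (hΔ : Δ = (2 : ℝ) ^ l) :
    ∀ S : Finset Q,
      |scaledFn (2 * Δ) f S - scaledFn Δ f S|
        ≤ (2 + (S.card : ℝ) * (Sᶜ.card : ℝ)) * (⌈Δ⌉ : ℝ) := by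
  intro S
  have hpos : 0 < Δ := by rw [hΔ]; positivity
  have key : (⌊2 * Δ⌋ : ℝ) - (⌊Δ⌋ : ℝ) = (⌈Δ⌉ : ℝ) := by
    rcases eq_or_lt_of_le hl with h | h
    · have hd : Δ = 1 / 2 := by rw [hΔ, ← h]; norm_num
      have h1 : ⌊2 * Δ⌋ = 1 := by rw [hd]; norm_num
      have h2 : ⌊Δ⌋ = 0 := by rw [Int.floor_eq_iff, hd]; norm_num
      have h3 : ⌈Δ⌉ = 1 := by rw [Int.ceil_eq_iff, hd]; norm_num
      rw [h1, h2, h3]; norm_num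
    · obtain ⟨n, rfl⟩ := Int.eq_ofNat_of_zero_le (show 0 ≤ l by omega)
      have hd : Δ = ((2 ^ n : ℤ) : ℝ) := by rw [hΔ]; push_cast; simp
      have h1 : ⌊2 * Δ⌋ = 2 * 2 ^ n := by
        rw [Int.floor_eq_iff, hd]; push_cast; constructor <;> linarith
      have h2 : ⌊Δ⌋ = 2 ^ n := by rw [hd]; exact Int.floor_intCast _
      have h3 : ⌈Δ⌉ = 2 ^ n := by rw [hd]; exact Int.ceil_intCast _
      rw [h1, h2, h3]; push_cast; ring
  have bnd : ∀ d : ℝ, 0 < d → d * (⌊f S / d⌋ : ℝ) ≤ f S ∧ f S < d * (⌊f S / d⌋ : ℝ) + d := by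
    intro d hd
    have e : d * (f S / d) = f S := by field_simp
    have a := mul_le_mul_of_nonneg_left (Int.floor_le (f S / d)) hd.le
    have b := mul_lt_mul_of_pos_left (Int.lt_floor_add_one (f S / d)) hd
    constructor <;> linarith
  obtain ⟨a1, a2⟩ := bnd Δ hpos
  obtain ⟨b1, b2⟩ := bnd (2 * Δ) (by linarith)
  have hc := Int.le_ceil Δ
  have hp : 0 ≤ (S.card : ℝ) * (Sᶜ.card : ℝ) := by positivity
  have hm : 0 ≤ ((S.card : ℝ) * (Sᶜ.card : ℝ)) * (⌈Δ⌉ : ℝ) :=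
    mul_nonneg hp (by linarith)
  have hk : (⌊2 * Δ⌋ : ℝ) * ((S.card : ℝ) * (Sᶜ.card : ℝ))
      - (⌊Δ⌋ : ℝ) * ((S.card : ℝ) * (Sᶜ.card : ℝ))
      = ((S.card : ℝ) * (Sᶜ.card : ℝ)) * (⌈Δ⌉ : ℝ) := by rw [← key]; ring
  unfold scaledFn
  rw [add_mul, abs_le]
  constructor <;> linarith
end
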